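/- There exists an integer M such that for all integers m, n ≥ M, the number of unordered pairs {P, P′} of arc-disjoint hamiltonian paths in the Cayley digraph Cay(ℤ_m × ℤ_n; e₁, e₂) is greater than m²n²/10. -/

import Mathlib

/-- The arc set of a path `v : Fin N → G`: the pairs `(v i, v (i+1))`. -/
def ArcSet {G : Type*} (N : ℕ) (v : Fin N → G) : Set (G × G) :=
  {p | ∃ (i : ℕ) (h : i + 1 < N), p = (v ⟨i, Nat.lt_of_succ_lt h⟩, v ⟨i + 1, h⟩)}

/-- `v : Fin N → G` is a hamiltonian path of the Cayley digraph `Cay(G; a, b)`. -/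
def IsHamPath {G : Type*} [AddCommGroup G] (a b : G) (N : ℕ) (v : Fin N → G) : Prop :=
  Function.Bijective v ∧
    ∀ (i : ℕ) (h : i + 1 < N),
      v ⟨i + 1, h⟩ - v ⟨i, Nat.lt_of_succ_lt h⟩ ∈ ({a, b} : Set G)

section RotationNumber

variable {G : Type*} [AddCommGroup G]

open Classical in
/-- From `v`, move by `a` if `v ∈ W` and by `b` otherwise. -/
noncomputable def step (a b : G) (W : Set G) (v : G) : G := if v ∈ W then v + a else v + b

open Classical in
/-- The number of `a`-moves among the first `t` moves of the walk of `step a b W` from `v`. -/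
noncomputable def stepCount (a b : G) (W : Set G) (v : G) (t : ℕ) : ℤ :=
  ∑ i ∈ Finset.range t, if (step a b W)^[i] v ∈ W then 1 else 0

variable {a b : G} {W W' : Set G}

lemma stepCount_succ (v : G) (t : ℕ) [Decidable ((step a b W)^[t] v ∈ W)] :
    stepCount a b W v (t + 1) =
      stepCount a b W v t + if (step a b W)^[t] v ∈ W then 1 else 0 := by
  unfold stepCount
  rw [Finset.sum_range_succ]
  congr

lemma stepCount_zero (v : G) : stepCount a b W v 0 = 0 := by simp [stepCount]

lemma stepCount_add (v : G) (s t : ℕ) :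
    stepCount a b W v (s + t) =
      stepCount a b W v s + stepCount a b W ((step a b W)^[s] v) t := by
  classical
  induction t with
  | zero => simp [stepCount_zero]
  | succ t ih =>
    rw [← add_assoc, stepCount_succ, ih, stepCount_succ, ← Function.iterate_add_apply,
      add_comm t s, add_assoc]

lemma stepCount_nonneg (v : G) (t : ℕ) : 0 ≤ stepCount a b W v t :=
  Finset.sum_nonneg fun _ _ => by split_ifs <;> simp

lemma stepCount_le (v : G) (t : ℕ) : stepCount a b W v t ≤ t := by
  classical
  induction t with
  | zero => simp [stepCount_zero]
  | succ t ih => rw [stepCount_succ]; push_cast; split_ifs <;> linarith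

lemma iterate_step (v : G) (t : ℕ) :
    (step a b W)^[t] v = v + t • b + stepCount a b W v t • (a - b) := by
  classical
  induction t with
  | zero => simp [stepCount_zero]
  | succ t ih =>
    rw [stepCount_succ, Function.iterate_succ_apply']
    generalize hu : (step a b W)^[t] v = u at *
    rw [step]
    split_ifs
    · rw [ih]; module
    · rw [ih]; module

/-- Two walks on the same coset of `⟨a - b⟩` do not cross. -/
lemma stepCount_le_add (v : G) {j : ℤ} (hj : 0 ≤ j) (t : ℕ) :
    stepCount a b W v t ≤ j + stepCount a b W (v + j • (a - b)) t := by
  classical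
  induction t with
  | zero => simpa [stepCount_zero] using hj
  | succ t ih =>
    rcases ih.lt_or_eq with h | h
    · rw [stepCount_succ, stepCount_succ]
      split_ifs <;> linarith
    · have : (step a b W)^[t] v = (step a b W)^[t] (v + j • (a - b)) := by
        rw [iterate_step, iterate_step, h]; module
      rw [stepCount_succ, stepCount_succ, this, h, add_assoc]

lemma exists_stepCount_le_add [Finite G] (v : G) (j : ℤ) :
    ∃ C : ℤ, ∀ t, stepCount a b W v t ≤ C + stepCount a b W (v + j • (a - b)) t := by
  refine ⟨j % addOrderOf (a - b), fun t => ?_⟩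
  have hL : (addOrderOf (a - b) : ℤ) ≠ 0 := by exact_mod_cast (addOrderOf_pos (a - b)).ne'
  have := stepCount_le_add (a := a) (b := b) (W := W) v (Int.emod_nonneg j hL) t
  rwa [mod_addOrderOf_zsmul] at this

lemma nonpos_of_forall_nat_mul_le {y C : ℝ} (h : ∀ k : ℕ, k * y ≤ C) : y ≤ 0 := by
  by_contra! hy
  obtain ⟨k, hk⟩ := exists_nat_gt (C / y)
  rw [div_lt_iff₀ hy] at hk
  exact absurd (h k) (not_le.2 hk)

/-- The walks of `step a b W` have a common asymptotic frequency of `a`-moves. -/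
lemma exists_rotationNumber [Finite G] (hgen : ∀ v : G, ∃ i : ℕ, ∃ j : ℤ, v = i • b + j • (a - b))
    (W : Set G) :
    ∃ θ : ℝ, ∀ v : G, ∃ C : ℝ, ∀ t : ℕ, |(stepCount a b W v t : ℝ) - t * θ| ≤ C := by
  obtain ⟨s, t, hst, heq⟩ : ∃ s t, s < t ∧ (step a b W)^[s] 0 = (step a b W)^[t] 0 := by
    obtain ⟨s, t, hne, h⟩ := Finite.exists_ne_map_eq_of_infinite fun i => (step a b W)^[i] 0
    rcases hne.lt_or_gt with h' | h'
    · exact ⟨s, t, h', h⟩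
    · exact ⟨t, s, h', h.symm⟩
  obtain ⟨ℓ, rfl⟩ := Nat.exists_eq_add_of_lt hst
  set v₀ := (step a b W)^[s] 0 with hv₀
  have hper : (step a b W)^[ℓ + 1] v₀ = v₀ := by
    rw [hv₀, ← Function.iterate_add_apply, show ℓ + 1 + s = s + ℓ + 1 by ring, ← heq]
  have hmul : ∀ k : ℕ, stepCount a b W v₀ (k * (ℓ + 1)) = k * stepCount a b W v₀ (ℓ + 1) := by
    intro k
    induction k with
    | zero => simp [stepCount_zero]
    | succ k ih =>
      rw [show (k + 1) * (ℓ + 1) = (ℓ + 1) + k * (ℓ + 1) by ring, stepCount_add, hper, ih]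
      push_cast; ring
  have hperk : ∀ k : ℕ, (step a b W)^[k * (ℓ + 1)] v₀ = v₀ := fun k => by
    rw [mul_comm, Function.iterate_mul]
    exact Function.iterate_fixed hper k
  set p := stepCount a b W v₀ (ℓ + 1) with hp
  have hp0 : (0 : ℝ) ≤ p := by exact_mod_cast stepCount_nonneg v₀ (ℓ + 1)
  have hp1 : (p : ℝ) ≤ ℓ + 1 := by exact_mod_cast stepCount_le v₀ (ℓ + 1)
  have hℓ : (0 : ℝ) < ℓ + 1 := by positivity
  refine ⟨p / (ℓ + 1), fun v => ?_⟩
  have key : ∀ t : ℕ, |(stepCount a b W v₀ t : ℝ) - t * (p / (ℓ + 1))| ≤ ℓ + 1 := by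
    intro t
    have h1 : stepCount a b W v₀ t = (t / (ℓ + 1) : ℕ) * p + stepCount a b W v₀ (t % (ℓ + 1)) := by
      conv_lhs => rw [← Nat.div_add_mod' t (ℓ + 1)]
      rw [stepCount_add, hperk, hmul]
    have h2 : (t : ℝ) = (t / (ℓ + 1) : ℕ) * (ℓ + 1) + (t % (ℓ + 1) : ℕ) := by
      exact_mod_cast (Nat.div_add_mod' t (ℓ + 1)).symm
    have h3 : (stepCount a b W v₀ t : ℝ) - t * (p / (ℓ + 1)) =
        stepCount a b W v₀ (t % (ℓ + 1)) - (t % (ℓ + 1) : ℕ) * (p / (ℓ + 1)) := by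
      rw [h1, Int.cast_add, Int.cast_mul, Int.cast_natCast]
      rw [h2]
      field_simp
      ring
    have h4 : ((t % (ℓ + 1) : ℕ) : ℝ) ≤ ℓ + 1 := by
      exact_mod_cast (Nat.mod_lt t (Nat.succ_pos ℓ)).le
    have h5 : (0 : ℝ) ≤ stepCount a b W v₀ (t % (ℓ + 1)) := by
      exact_mod_cast stepCount_nonneg v₀ (t % (ℓ + 1))
    have h6 : (stepCount a b W v₀ (t % (ℓ + 1)) : ℝ) ≤ (t % (ℓ + 1) : ℕ) := by
      have := stepCount_le (a := a) (b := b) (W := W) v₀ (t % (ℓ + 1))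
      rw [← Int.cast_natCast]
      exact Int.cast_le.2 this
    have h7 : (p : ℝ) / (ℓ + 1) ≤ 1 := (div_le_one hℓ).2 hp1
    have h8 : (0 : ℝ) ≤ p / (ℓ + 1) := by positivity
    rw [h3, abs_le]
    constructor <;> nlinarith [Nat.cast_nonneg (α := ℝ) (t % (ℓ + 1))]
  obtain ⟨i, j, hij⟩ := hgen (v - v₀)
  set u := (step a b W)^[i] v₀ with hu
  have hvu : v = u + (j - stepCount a b W v₀ i) • (a - b) := by
    rw [hu, iterate_step, eq_add_of_sub_eq hij]; module
  obtain ⟨C₁, hC₁⟩ := exists_stepCount_le_add (a := a) (b := b) (W := W) u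
    (j - stepCount a b W v₀ i)
  obtain ⟨C₂, hC₂⟩ := exists_stepCount_le_add (a := a) (b := b) (W := W) v
    (-(j - stepCount a b W v₀ i))
  have huv : v + (-(j - stepCount a b W v₀ i)) • (a - b) = u := by rw [hvu]; module
  rw [← hvu] at hC₁
  rw [huv] at hC₂
  refine ⟨|(C₁ : ℝ)| + |(C₂ : ℝ)| + i + (ℓ + 1) + i, fun t => ?_⟩
  have e1 : (stepCount a b W v₀ (i + t) : ℝ) = stepCount a b W v₀ i + stepCount a b W u t := by
    exact_mod_cast stepCount_add v₀ i t
  have e2 : (stepCount a b W u t : ℝ) ≤ C₁ + stepCount a b W v t := by exact_mod_cast hC₁ t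
  have e3 : (stepCount a b W v t : ℝ) ≤ C₂ + stepCount a b W u t := by exact_mod_cast hC₂ t
  have e4 := key (i + t)
  have e5 : (0 : ℝ) ≤ stepCount a b W v₀ i := by exact_mod_cast stepCount_nonneg v₀ i
  have e6 : (stepCount a b W v₀ i : ℝ) ≤ i := by exact_mod_cast stepCount_le v₀ i
  have h7 : (p : ℝ) / (ℓ + 1) ≤ 1 := (div_le_one hℓ).2 hp1
  have h8 : (0 : ℝ) ≤ p / (ℓ + 1) := by positivity
  have h9 : (i : ℝ) * (p / (ℓ + 1)) ≤ i := mul_le_of_le_one_right (Nat.cast_nonneg i) h7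
  have h10 : (0 : ℝ) ≤ i * (p / (ℓ + 1)) := by positivity
  push_cast at e4
  rw [abs_le] at e4 ⊢
  constructor <;>
    linarith [le_abs_self (C₁ : ℝ), le_abs_self (C₂ : ℝ), abs_nonneg (C₁ : ℝ),
      abs_nonneg (C₂ : ℝ)]

lemma eq_of_stepCount_eq {θ θ' C C' : ℝ} {v : G}
    (h : ∀ t : ℕ, |(stepCount a b W v t : ℝ) - t * θ| ≤ C)
    (h' : ∀ t : ℕ, |(stepCount a b W' v t : ℝ) - t * θ'| ≤ C')
    (heq : ∀ t, stepCount a b W v t = stepCount a b W' v t) : θ = θ' := by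
  have key : ∀ k : ℕ, |k * (θ - θ')| ≤ C + C' := fun k => by
    have h1 := h k
    have h2 := h' k
    rw [heq] at h1
    rw [abs_le] at *
    constructor <;> linarith
  apply le_antisymm
  · linarith [nonpos_of_forall_nat_mul_le fun k : ℕ => (le_abs_self _).trans (key k)]
  · have := nonpos_of_forall_nat_mul_le (y := θ' - θ) (C := C + C') fun k : ℕ => by
      have := neg_abs_le ((k : ℝ) * (θ - θ'))
      linarith [key k]
    linarith

/-- If `ℓ` moves, `p` of them by `a`, form a closed walk, then the number of `a`-moves among the
first `ℓ` moves of one walk compares the rotation number with `p / ℓ`. -/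
lemma le_rotationNumber {θ C : ℝ} {v : G} {ℓ : ℕ} {p : ℤ}
    (h : ∀ t : ℕ, |(stepCount a b W v t : ℝ) - t * θ| ≤ C)
    (hclosed : ℓ • b + p • (a - b) = 0) (hp : p ≤ stepCount a b W v ℓ) :
    (p : ℝ) ≤ ℓ * θ := by
  have hk : ∀ k : ℕ, k * p ≤ stepCount a b W v (k * ℓ) := by
    intro k
    induction k with
    | zero => simp [stepCount_zero]
    | succ k ih =>
      have h1 := stepCount_le_add (a := a) (b := b) (W := W) v (sub_nonneg.2 hp) (k * ℓ)
      have h2 : (step a b W)^[ℓ] v = v + (stepCount a b W v ℓ - p) • (a - b) := by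
        rw [iterate_step, eq_neg_of_add_eq_zero_left hclosed]; module
      rw [show (k + 1) * ℓ = ℓ + k * ℓ by ring, stepCount_add, h2]
      push_cast
      linarith
  have := nonpos_of_forall_nat_mul_le (y := p - ℓ * θ) (C := C) fun k => by
    have h1 : ((k : ℝ) * p) ≤ stepCount a b W v (k * ℓ) := by exact_mod_cast hk k
    have h2 := (abs_le.1 (h (k * ℓ))).2
    push_cast at h2
    linarith
  linarith

lemma rotationNumber_le {θ C : ℝ} {v : G} {ℓ : ℕ} {p : ℤ}
    (h : ∀ t : ℕ, |(stepCount a b W v t : ℝ) - t * θ| ≤ C)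
    (hclosed : ℓ • b + p • (a - b) = 0) (hp : stepCount a b W v ℓ ≤ p) :
    ℓ * θ ≤ p := by
  have hk : ∀ k : ℕ, stepCount a b W v (k * ℓ) ≤ k * p := by
    intro k
    induction k with
    | zero => simp [stepCount_zero]
    | succ k ih =>
      have h1 := stepCount_le_add (a := a) (b := b) (W := W) ((step a b W)^[ℓ] v)
        (sub_nonneg.2 hp) (k * ℓ)
      have h2 : (step a b W)^[ℓ] v + (p - stepCount a b W v ℓ) • (a - b) = v := by
        rw [iterate_step, eq_neg_of_add_eq_zero_left hclosed]; module
      rw [h2] at h1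
      rw [show (k + 1) * ℓ = ℓ + k * ℓ by ring, stepCount_add]
      push_cast
      linarith
  have := nonpos_of_forall_nat_mul_le (y := ℓ * θ - p) (C := C) fun k => by
    have h1 : (stepCount a b W v (k * ℓ) : ℝ) ≤ k * p := by exact_mod_cast hk k
    have h2 := (abs_le.1 (h (k * ℓ))).1
    push_cast at h2
    linarith
  linarith

end RotationNumber

section Reroute

variable {G : Type*}

lemma iterate_eq_of_ne {f g : G → G} {τ v : G} (hfg : ∀ u ≠ τ, f u = g u) {i : ℕ}
    (hi : ∀ j < i, f^[j] v ≠ τ) : f^[i] v = g^[i] v := by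
  induction i with
  | zero => rfl
  | succ i ih =>
    rw [Function.iterate_succ_apply', Function.iterate_succ_apply', ← ih fun j hj => hi j (by omega)]
    exact hfg _ (hi i (by omega))

variable [AddCommGroup G] {a b : G} {W : Set G} {τ ι : G}

/-- Every walk of `step a b W` reaches `τ`. -/
def Reaches (a b : G) (W : Set G) (τ : G) : Prop := ∀ v, ∃ i, (step a b W)^[i] v = τ

lemma step_insert {u : G} (hu : u ≠ τ) : step a b W u = step a b (insert τ W) u := by
  have h : u ∈ insert τ W ↔ u ∈ W := by simp [hu]
  by_cases hW : u ∈ W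
  · rw [step, step, if_pos hW, if_pos (h.2 hW)]
  · rw [step, step, if_neg hW, if_neg (h.not.2 hW)]

lemma stepCount_insert {v : G} {t : ℕ} (h : ∀ j < t, (step a b W)^[j] v ≠ τ) :
    stepCount a b W v t = stepCount a b (insert τ W) v t := by
  classical
  unfold stepCount
  refine Finset.sum_congr rfl fun i hi => ?_
  rw [Finset.mem_range] at hi
  rw [← iterate_eq_of_ne (fun u hu => step_insert hu) fun j hj => h j (hj.trans hi)]
  simp [h i hi]

/-- `π` follows `step a b W`, except that it sends `τ` to `ι`. -/
structure IsReroute (a b : G) (W : Set G) (τ ι : G) (π : Equiv.Perm G) : Prop where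
  notMem : τ ∉ W
  apply_self : π τ = ι
  apply_of_ne : ∀ v ≠ τ, π v = step a b W v

variable {π : Equiv.Perm G}

lemma IsReroute.isCycleOn (h : IsReroute a b W τ ι π) (hr : Reaches a b W τ) :
    π.IsCycleOn Set.univ := by
  have key : ∀ v, π.SameCycle v τ := fun v => by
    classical
    refine ⟨(Nat.find (hr v) : ℕ), ?_⟩
    rw [zpow_natCast, ← Equiv.Perm.iterate_eq_pow, ← iterate_eq_of_ne
      (fun u hu => (h.apply_of_ne u hu).symm) fun j hj => Nat.find_min (hr v) hj]
    exact Nat.find_spec (hr v)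
  exact ⟨π.bijective.bijOn_univ, fun x _ y _ => (key x).trans (key y).symm⟩

lemma IsReroute.sign_eq [Fintype G] [DecidableEq G] (h : IsReroute a b W τ ι π)
    (hr : Reaches a b W τ) [Nontrivial G] :
    Equiv.Perm.sign π = -(-1) ^ Fintype.card G := by
  have hc := h.isCycleOn hr
  have hne : ∀ x, π x ≠ x := fun x => hc.apply_ne Set.nontrivial_univ (Set.mem_univ x)
  have hcyc : π.IsCycle := ⟨τ, hne τ, fun y _ => hc.2 (Set.mem_univ _) (Set.mem_univ _)⟩
  rw [hcyc.sign, ← Finset.card_univ]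
  congr 3
  ext x
  simp [hne x]

lemma IsReroute.pow_apply_ne [Fintype G] (h : IsReroute a b W τ ι π) (hr : Reaches a b W τ)
    {i : ℕ} (hi : i + 1 < Fintype.card G) : (π ^ i) ι ≠ τ := by
  have hc : π.IsCycleOn (Finset.univ : Finset G) := by simpa using h.isCycleOn hr
  rw [← h.apply_self, ← Equiv.Perm.mul_apply, ← pow_succ, Ne,
    hc.pow_apply_eq (Finset.mem_univ τ), Finset.card_univ]
  exact fun hd => absurd (Nat.le_of_dvd (Nat.succ_pos i) hd) (by omega)

lemma IsReroute.iterate_ne [Fintype G] (h : IsReroute a b W τ ι π) (hr : Reaches a b W τ)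
    {i : ℕ} (hi : i + 1 < Fintype.card G) : (step a b W)^[i] ι ≠ τ := by
  rw [← iterate_eq_of_ne (f := π) h.apply_of_ne fun j hj => by
    rw [Equiv.Perm.iterate_eq_pow]; exact h.pow_apply_ne hr (by omega), Equiv.Perm.iterate_eq_pow]
  exact h.pow_apply_ne hr hi

/-- `p` is a hamiltonian path from `ι` to `τ` that leaves exactly the vertices of `W` by `a`. -/
structure Realizes (a b : G) (N : ℕ) (p : Fin N → G) (W : Set G) (τ ι : G) : Prop where
  isHamPath : IsHamPath a b N p
  first : ∀ h : 0 < N, p ⟨0, h⟩ = ι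
  last : ∀ i (h : i < N), i + 1 = N → p ⟨i, h⟩ = τ
  mem_arcSet : ∀ e, e ∈ ArcSet N p ↔
    (e.1 ∈ W ∧ e.2 = e.1 + a) ∨ (e.1 ∉ W ∧ e.1 ≠ τ ∧ e.2 = e.1 + b)

lemma IsReroute.exists_realizes [Fintype G] (h : IsReroute a b W τ ι π) (hr : Reaches a b W τ) :
    ∃ p, Realizes a b (Fintype.card G) p W τ ι := by
  have hc : π.IsCycleOn (Finset.univ : Finset G) := by simpa using h.isCycleOn hr
  have hlast : ∀ i, i + 1 = Fintype.card G → (π ^ i) ι = τ := fun i hi => by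
    rw [← h.apply_self, ← Equiv.Perm.mul_apply, ← pow_succ, hi, ← Finset.card_univ]
    exact hc.pow_card_apply (Finset.mem_univ τ)
  have hstep : ∀ i, i + 1 < Fintype.card G → (π ^ (i + 1)) ι = step a b W ((π ^ i) ι) :=
    fun i hi => by
      rw [pow_succ', Equiv.Perm.mul_apply]
      exact h.apply_of_ne _ (h.pow_apply_ne hr hi)
  have hsurj : ∀ u, ∃ i < Fintype.card G, (π ^ i) ι = u := fun u => by
    obtain ⟨i, hi, rfl⟩ := hc.exists_pow_eq (Finset.mem_univ ι) (Finset.mem_univ u)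
    exact ⟨i, hi, rfl⟩
  refine ⟨fun i => (π ^ (i : ℕ)) ι, ⟨?_, fun i hi => ?_⟩, fun _ => by simp, fun i _ => hlast i, ?_⟩
  · refine (Fintype.bijective_iff_surjective_and_card _).2 ⟨fun u => ?_, by simp⟩
    obtain ⟨i, hi, hu⟩ := hsurj u
    exact ⟨⟨i, hi⟩, hu⟩
  · simp only [hstep i hi, step]
    split_ifs <;> simp
  · rintro ⟨u, w⟩
    constructor
    · rintro ⟨i, hi, he⟩
      obtain ⟨rfl, rfl⟩ := Prod.mk.inj he
      simp only [hstep i hi, step]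
      by_cases hm : (π ^ i) ι ∈ W
      · simp [hm]
      · simp [hm, h.pow_apply_ne hr hi]
    · intro hu
      obtain ⟨i, hi, rfl⟩ := hsurj u
      have hne : (π ^ i) ι ≠ τ := by
        rcases hu with hu | hu
        · exact fun h' => h.notMem (h' ▸ hu.1)
        · exact hu.2.1
      have hi' : i + 1 < Fintype.card G := lt_of_le_of_ne hi fun h' => hne (hlast i h')
      refine ⟨i, hi', Prod.ext rfl ?_⟩
      simp only [hstep i hi', step]
      rcases hu with hu | hu
      · simpa [hu.1] using hu.2
      · simpa [hu.1] using hu.2.2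

lemma mem_arcSet_translate {N : ℕ} {p : Fin N → G} {t : G} {e : G × G} :
    e ∈ ArcSet N (fun i => p i + t) ↔ (e.1 - t, e.2 - t) ∈ ArcSet N p := by
  constructor
  · rintro ⟨i, hi, rfl⟩
    exact ⟨i, hi, by simp⟩
  · rintro ⟨i, hi, he⟩
    obtain ⟨h1, h2⟩ := Prod.mk.inj he
    exact ⟨i, hi, Prod.ext (by simp [← h1]) (by simp [← h2])⟩

lemma disjoint_arcSet_translate {N : ℕ} {p q : Fin N → G}
    (h : Disjoint (ArcSet N p) (ArcSet N q)) (t : G) :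
    Disjoint (ArcSet N fun i => p i + t) (ArcSet N fun i => q i + t) :=
  Set.disjoint_left.2 fun _ he he' =>
    Set.disjoint_left.1 h (mem_arcSet_translate.1 he) (mem_arcSet_translate.1 he')

lemma Realizes.translate {N : ℕ} {p : Fin N → G} (h : Realizes a b N p W τ ι) (t : G) :
    Realizes a b N (fun i => p i + t) {v | v - t ∈ W} (τ + t) (ι + t) where
  isHamPath := ⟨(Equiv.addRight t).bijective.comp h.isHamPath.1, fun i hi => by
    simpa using h.isHamPath.2 i hi⟩
  first h0 := by rw [h.first h0]
  last i hi hi' := by rw [h.last i hi hi']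
  mem_arcSet e := by
    rw [mem_arcSet_translate, h.mem_arcSet]
    simp only [Set.mem_ofPred_eq, Ne, sub_eq_iff_eq_add,
      show ∀ x, e.1 - t + x + t = e.1 + x from fun x => by abel]

end Reroute

section CosetChain

variable {G : Type*} [AddCommGroup G]

/-- An enumeration `0, …, g - 1` of the cosets of `⟨δ⟩`, given by the index `κ v` of the coset of
`v`, together with a base point `β k` of the `k`-th coset. -/
structure IsCosetChain (δ : G) (g : ℕ) (κ : G → ℕ) (β : ℕ → G) : Prop where
  lt : ∀ v, κ v < g
  add_zsmul : ∀ v (j : ℤ), κ (v + j • δ) = κ v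
  base : ∀ k < g, κ (β k) = k
  exists_eq : ∀ v, ∃ j < addOrderOf δ, v = β (κ v) + j • δ

/-- The first `k` cosets, together with the first `r` elements of the next one. -/
def chainSet (δ : G) (κ : G → ℕ) (β : ℕ → G) (k r : ℕ) : Set G :=
  {v | κ v < k ∨ ∃ j < r, v = β k + j • δ}

variable {a b δ : G} {g : ℕ} {κ : G → ℕ} {β : ℕ → G} {k r : ℕ}

lemma IsCosetChain.reverse (h : IsCosetChain δ g κ β) :
    IsCosetChain δ g (fun v => g - 1 - κ v) (fun k => β (g - 1 - k)) where
  lt v := by have := h.lt v; omega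
  add_zsmul v j := by simp only [h.add_zsmul]
  base k hk := by simp only [h.base (g - 1 - k) (by omega)]; omega
  exists_eq v := by
    have := h.lt v
    simpa [show g - 1 - (g - 1 - κ v) = κ v by omega] using h.exists_eq v

lemma IsCosetChain.add_nsmul (h : IsCosetChain δ g κ β) (v : G) (j : ℕ) :
    κ (v + j • δ) = κ v := by
  simpa using h.add_zsmul v j

lemma nsmul_eq_nsmul_iff_of_lt {i j : ℕ} (hi : i < addOrderOf δ) (hj : j < addOrderOf δ) :
    i • δ = j • δ ↔ i = j :=
  ⟨fun h => nsmul_injOn_Iio_addOrderOf hi hj h, fun h => h ▸ rfl⟩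

lemma IsCosetChain.add_mem_chainSet_iff (h : IsCosetChain δ g κ β) (hk : k < g)
    (hr : r ≤ addOrderOf δ) {j : ℕ} (hj : j < addOrderOf δ) :
    β k + j • δ ∈ chainSet δ κ β k r ↔ j < r := by
  simp only [chainSet, Set.mem_ofPred_eq, h.add_nsmul, h.base k hk, lt_irrefl, false_or,
    add_right_inj]
  constructor
  · rintro ⟨i, hi, hij⟩
    rwa [(nsmul_eq_nsmul_iff_of_lt hj (hi.trans_le hr)).1 hij]
  · exact fun hjr => ⟨j, hjr, rfl⟩

lemma chainSet_succ : chainSet δ κ β k (r + 1) = insert (β k + r • δ) (chainSet δ κ β k r) := by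
  ext v
  simp only [chainSet, Set.mem_ofPred_eq, Set.mem_insert_iff, Nat.lt_succ_iff_lt_or_eq, or_and_right,
    exists_or, exists_eq_left]
  rw [← or_assoc, or_comm]

lemma IsCosetChain.chainSet_addOrderOf (h : IsCosetChain δ g κ β) (hk : k < g) :
    chainSet δ κ β k (addOrderOf δ) = chainSet δ κ β (k + 1) 0 := by
  ext v
  simp only [chainSet, Set.mem_ofPred_eq, not_lt_zero, false_and, exists_false, or_false,
    Nat.lt_succ_iff_lt_or_eq]
  refine or_congr_right ⟨?_, ?_⟩
  · rintro ⟨j, -, rfl⟩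
    rw [h.add_nsmul, h.base k hk]
  · rintro rfl
    exact h.exists_eq v

lemma IsCosetChain.exists_reroute [Finite G] (h : IsCosetChain (a - b) g κ β) (hk : k < g)
    (hr : r < addOrderOf (a - b)) :
    ∃ π, IsReroute a b (chainSet (a - b) κ β k r) (β k + r • (a - b)) (β k + b) π := by
  classical
  set W := chainSet (a - b) κ β k r with hW
  have hτ : β k + r • (a - b) ∉ W := by
    rw [hW, h.add_mem_chainSet_iff hk hr.le hr]; exact lt_irrefl r
  -- where a collision between an `a`-move and a `b`-move would have to take place
  have hcol : ∀ u v, u ∈ W → u + (a - b) = v → v ∈ W ∨ (v = β k + r • (a - b) ∧ 0 < r) := by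
    rintro u v (hu | ⟨j, hj, rfl⟩) rfl
    · left; left
      simpa using (h.add_nsmul u 1).trans_lt hu
    · rcases (Nat.succ_le_of_lt hj).lt_or_eq with hj' | hj'
      · left; right
        exact ⟨j + 1, hj', by module⟩
      · right
        exact ⟨by rw [← hj', Nat.succ_eq_add_one]; module, by omega⟩
  have hβ : β k ∈ W ∨ (β k = β k + r • (a - b) ∧ r = 0) := by
    rcases Nat.eq_zero_or_pos r with rfl | h0
    · simp
    · left; right
      exact ⟨0, h0, by simp⟩
  have hβ' : ∀ u ∈ W, u + (a - b) ≠ β k := by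
    rintro u (hu | ⟨j, hj, rfl⟩) he
    · have := h.add_nsmul u 1
      rw [one_smul, he, h.base k hk] at this
      omega
    · have h0 : (j + 1) • (a - b) = 0 := by
        have : β k + (j + 1) • (a - b) = β k := by rw [← he]; nth_rewrite 2 [← he]; module
        simpa using this
      exact absurd (Nat.le_of_dvd (Nat.succ_pos j) (addOrderOf_dvd_of_nsmul_eq_zero h0)) (by omega)
  set f : G → G := Function.update (step a b W) (β k + r • (a - b)) (β k + b) with hf
  have hinj : Function.Injective f := by
    have hne : ∀ v ≠ β k + r • (a - b), f v = β k + b → False := by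
      intro v hv hfv
      rw [hf, Function.update_of_ne hv, step] at hfv
      split_ifs at hfv with hm
      · exact hβ' v hm (by rw [← add_sub_assoc, hfv, add_sub_cancel_right])
      · rw [add_left_inj] at hfv
        subst hfv
        rcases hβ with h' | h'
        · exact hm h'
        · exact hv h'.1
    have hmix : ∀ u v, u ∈ W → v ∉ W → v ≠ β k + r • (a - b) → u + a = v + b → False := by
      intro u v hu hv hvτ he
      rcases hcol u v hu (by rw [← add_sub_assoc, he, add_sub_cancel_right]) with h' | h'
      · exact hv h'
      · exact hvτ h'.1
    intro u v huv
    by_cases hu : u = β k + r • (a - b) <;> by_cases hv : v = β k + r • (a - b)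
    · rw [hu, hv]
    · exact (hne v hv (by rw [← huv, hu, hf, Function.update_self])).elim
    · exact (hne u hu (by rw [huv, hv, hf, Function.update_self])).elim
    · rw [hf, Function.update_of_ne hu, Function.update_of_ne hv, step, step] at huv
      split_ifs at huv with h1 h2 h2
      · exact add_right_cancel huv
      · exact (hmix u v h1 h2 hv huv).elim
      · exact (hmix v u h2 h1 hu huv.symm).elim
      · exact add_right_cancel huv
  exact ⟨Equiv.ofBijective f (Finite.injective_iff_bijective.1 hinj), hτ,
    by simp [hf], fun v hv => by simp [hf, hv]⟩

/-- Whether the walk that starts with the chain data `(k, r)` is a hamiltonian path. -/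
def IsGood (a b : G) (κ : G → ℕ) (β : ℕ → G) (k r : ℕ) : Prop :=
  Reaches a b (chainSet (a - b) κ β k r) (β k + r • (a - b))

lemma IsCosetChain.sign_succ [Fintype G] [DecidableEq G] (h : IsCosetChain (a - b) g κ β)
    (hk : k < g) (hr : r + 1 < addOrderOf (a - b)) {π π' : Equiv.Perm G}
    (hπ : IsReroute a b (chainSet (a - b) κ β k r) (β k + r • (a - b)) (β k + b) π)
    (hπ' : IsReroute a b (chainSet (a - b) κ β k (r + 1)) (β k + (r + 1) • (a - b)) (β k + b) π') :
    Equiv.Perm.sign π' = -Equiv.Perm.sign π := by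
  have hne : β k + r • (a - b) ≠ β k + (r + 1) • (a - b) := fun he => by
    rw [add_right_inj, nsmul_eq_nsmul_iff_of_lt (by omega) hr] at he
    omega
  have : π' = π * Equiv.swap (β k + r • (a - b)) (β k + (r + 1) • (a - b)) := by
    ext v
    rw [Equiv.Perm.mul_apply]
    by_cases h1 : v = β k + r • (a - b)
    · have hm := (h.add_mem_chainSet_iff hk hr.le (j := r) (by omega)).2 (Nat.lt_succ_self r)
      have hm' := (h.add_mem_chainSet_iff hk (r := r) (by omega) hr).not.2 (by omega)
      rw [h1, Equiv.swap_apply_left, hπ'.apply_of_ne _ hne, hπ.apply_of_ne _ hne.symm, step, step,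
        if_pos hm, if_neg hm']
      module
    · by_cases h2 : v = β k + (r + 1) • (a - b)
      · rw [h2, Equiv.swap_apply_right, hπ.apply_self, hπ'.apply_self]
      · rw [Equiv.swap_apply_of_ne_of_ne h1 h2, hπ.apply_of_ne _ h1, hπ'.apply_of_ne _ h2,
          chainSet_succ, ← step_insert h1]
  rw [this, Equiv.Perm.sign_mul, Equiv.Perm.sign_swap hne]
  simp

/-- In each coset, the parity of the good positions is determined. -/
lemma IsCosetChain.parity_eq [Finite G] [Nontrivial G] (h : IsCosetChain (a - b) g κ β)
    (hk : k < g) {r r' : ℕ} (hr : r < addOrderOf (a - b)) (hr' : r' < addOrderOf (a - b))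
    (hg : IsGood a b κ β k r) (hg' : IsGood a b κ β k r') : r % 2 = r' % 2 := by
  classical
  have := Fintype.ofFinite G
  have hex : ∃ ε : ℤˣ, ∀ i (hi : i < addOrderOf (a - b)),
      Equiv.Perm.sign (h.exists_reroute hk hi).choose = ε * (-1) ^ i := by
    refine ⟨Equiv.Perm.sign (h.exists_reroute hk (addOrderOf_pos (a - b))).choose, fun i hi => ?_⟩
    induction i with
    | zero => simp
    | succ i ih =>
      rw [h.sign_succ hk hi (h.exists_reroute hk (by omega)).choose_spec
        (h.exists_reroute hk hi).choose_spec, ih (by omega), pow_succ]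
      simp
  obtain ⟨ε, hε⟩ := hex
  have h1 := (h.exists_reroute hk hr).choose_spec.sign_eq hg
  have h2 := (h.exists_reroute hk hr').choose_spec.sign_eq hg'
  rw [hε _ hr] at h1
  rw [hε _ hr'] at h2
  have h3 : (-1 : ℤˣ) ^ r = (-1) ^ r' := mul_left_cancel (h1.trans h2.symm)
  rcases Nat.even_or_odd r with e | e <;> rcases Nat.even_or_odd r' with e' | e' <;>
    simp only [e.neg_one_pow, e'.neg_one_pow] at h3
  · rw [Nat.even_iff.1 e, Nat.even_iff.1 e']
  · exact absurd h3 (by decide)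
  · exact absurd h3 (by decide)
  · rw [Nat.odd_iff.1 e, Nat.odd_iff.1 e']

lemma card_le_one_add_card_jumps (ρ : ℕ → ℝ) (n : ℕ) :
    ((Finset.range (n + 1)).image ρ).card ≤
      1 + ((Finset.range n).filter fun d => ρ d ≠ ρ (d + 1)).card := by
  induction n with
  | zero => simp
  | succ n ih =>
    rw [Finset.range_add_one (n := n + 1), Finset.image_insert]
    have hn : n ∉ (Finset.range n).filter fun d => ρ d ≠ ρ (d + 1) := by simp
    by_cases hj : ρ n = ρ (n + 1)
    · rw [Finset.insert_eq_of_mem (hj ▸ Finset.mem_image_of_mem ρ (Finset.self_mem_range_succ n)),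
        Finset.range_add_one (n := n), Finset.filter_insert, if_neg (not_not.2 hj),
        ← Finset.range_add_one]
      exact ih
    · rw [Finset.range_add_one (n := n), Finset.filter_insert, if_pos hj,
        Finset.card_insert_of_notMem hn, ← Finset.range_add_one, ← add_assoc]
      exact (Finset.card_insert_le _ _).trans (Nat.succ_le_succ ih)

lemma card_filter_divMod_le (g L : ℕ) (P : ℕ → ℕ → Prop) [∀ k r, Decidable (P k r)] :
    ((Finset.range (g * L)).filter fun d => P (d / L) (d % L)).card ≤
      ∑ k ∈ Finset.range g, ((Finset.range L).filter (P k)).card := by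
  rw [Finset.card_eq_sum_card_fiberwise (f := (· / L)) (t := Finset.range g)]
  · refine Finset.sum_le_sum fun k _ => Finset.card_le_card_of_injOn (· % L) ?_ ?_
    · intro d hd
      simp only [Finset.coe_filter, Finset.mem_filter, Finset.mem_range, Set.mem_ofPred_eq] at hd ⊢
      refine ⟨Nat.mod_lt _ (Nat.pos_of_ne_zero fun h0 => ?_), hd.2 ▸ hd.1.2⟩
      simp [h0] at hd
    · intro d hd d' hd' he
      simp only [Finset.coe_filter, Finset.mem_filter, Set.mem_ofPred_eq] at hd hd' he
      rw [← Nat.div_add_mod d L, ← Nat.div_add_mod d' L, he, hd.2, hd'.2]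
  · intro d hd
    simp only [Finset.coe_filter, Finset.mem_range, Set.mem_ofPred_eq, Finset.coe_range,
      Set.mem_Iio] at hd ⊢
    exact Nat.div_lt_of_lt_mul (by rw [mul_comm]; exact hd.1)

lemma IsCosetChain.chainSet_divMod_succ [Finite G] (h : IsCosetChain δ g κ β) {L : ℕ}
    (hL : addOrderOf δ = L) {d : ℕ} (hd : d < g * L) :
    chainSet δ κ β ((d + 1) / L) ((d + 1) % L) =
      insert (β (d / L) + (d % L) • δ) (chainSet δ κ β (d / L) (d % L)) := by
  have hL0 : 0 < L := hL ▸ addOrderOf_pos δ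
  have hk : d / L < g := Nat.div_lt_of_lt_mul (by rwa [mul_comm])
  rw [← chainSet_succ]
  rcases (Nat.succ_le_of_lt (Nat.mod_lt d hL0)).lt_or_eq with hlt | heq
  · have hd' : d + 1 = (d % L + 1) + L * (d / L) := by have := Nat.mod_add_div d L; omega
    rw [hd', Nat.add_mul_div_left _ _ hL0, Nat.add_mul_mod_self_left,
      Nat.div_eq_of_lt hlt, Nat.mod_eq_of_lt hlt, zero_add]
  · have heq' : d % L + 1 = addOrderOf δ := heq.trans hL.symm
    have hd' : d + 1 = L * (d / L + 1) := by
      have := Nat.mod_add_div d L; rw [mul_add, mul_one]; omega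
    rw [heq', h.chainSet_addOrderOf hk, hd', Nat.mul_div_cancel_left _ hL0, Nat.mul_mod_right]

open Classical in
/-- The good positions in the `k`-th coset. -/
noncomputable def goodPositions (a b : G) (κ : G → ℕ) (β : ℕ → G) (k : ℕ) : Finset ℕ :=
  (Finset.range (addOrderOf (a - b))).filter (IsGood a b κ β k)

lemma mem_goodPositions :
    r ∈ goodPositions a b κ β k ↔ r < addOrderOf (a - b) ∧ IsGood a b κ β k r := by
  simp [goodPositions]

open Classical in
/-- Every slope of a closed walk that is shorter than a hamiltonian cycle is the rotation number of
some member of the chain, and the rotation number only changes at good positions. -/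
lemma IsCosetChain.card_le_one_add_card_good [Fintype G] (h : IsCosetChain (a - b) g κ β)
    (hgen : ∀ v : G, ∃ i : ℕ, ∃ j : ℤ, v = i • b + j • (a - b))
    (hcard : g * addOrderOf (a - b) = Fintype.card G) (F : Finset ℝ)
    (hF : ∀ x ∈ F, ∃ ℓ p : ℕ, 0 < p ∧ p < ℓ ∧ ℓ < Fintype.card G ∧
      ℓ • b + p • (a - b) = 0 ∧ (p : ℝ) = ℓ * x) :
    F.card ≤ 1 + ∑ k ∈ Finset.range g, (goodPositions a b κ β k).card := by
  unfold goodPositions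
  obtain ⟨L, hL⟩ : ∃ L, addOrderOf (a - b) = L := ⟨_, rfl⟩
  rw [hL] at hcard ⊢
  have hL0 : 0 < L := hL ▸ addOrderOf_pos (a - b)
  choose θ hθ using exists_rotationNumber hgen
  choose C hC using hθ
  obtain ⟨W, hW⟩ : ∃ W : ℕ → Set G, ∀ d, W d = chainSet (a - b) κ β (d / L) (d % L) :=
    ⟨_, fun _ => rfl⟩
  have hsucc : ∀ d < g * L, W (d + 1) = insert (β (d / L) + (d % L) • (a - b)) (W d) :=
    fun d hd => by rw [hW, hW, h.chainSet_divMod_succ hL hd]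
  have hbad : ∀ d < g * L, ¬ IsGood a b κ β (d / L) (d % L) → θ (W d) = θ (W (d + 1)) := by
    intro d hd hng
    simp only [IsGood, Reaches, not_forall, not_exists] at hng
    obtain ⟨v, hv⟩ := hng
    refine eq_of_stepCount_eq (hC (W d) v) (hC (W (d + 1)) v) fun t => ?_
    rw [hsucc d hd]
    rw [← hW] at hv
    exact stepCount_insert fun j _ => hv j
  have hex : ∀ x ∈ F, ∃ d ∈ Finset.range (g * L + 1), θ (W d) = x := by
    intro x hx
    obtain ⟨ℓ, p, hp, hpℓ, hℓ, hclosed, hpx⟩ := hF x hx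
    have hℓ0 : (0 : ℝ) < ℓ := by exact_mod_cast hp.trans hpℓ
    have hclosed' : ℓ • b + (p : ℤ) • (a - b) = 0 := by simpa using hclosed
    by_contra! hno
    have hall : ∀ d ≤ g * L, θ (W d) < x := by
      intro d
      induction d with
      | zero =>
        intro _
        have hempty : stepCount a b (W 0) 0 ℓ ≤ (p : ℤ) := by
          have hW0 : W 0 = ∅ := by ext v; simp [hW, chainSet]
          simp [hW0, stepCount]
        have := rotationNumber_le (hC (W 0) 0) hclosed' hempty
        push_cast at this
        rw [hpx] at this
        exact lt_of_le_of_ne (le_of_mul_le_mul_left this hℓ0) (hno 0 (by simp))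
      | succ d ih =>
        intro hd
        have hlt := ih (by omega)
        have hd' : d < g * L := hd
        by_contra! hge
        have hgt : x < θ (W (d + 1)) :=
          lt_of_le_of_ne hge (hno (d + 1) (Finset.mem_range.2 (by omega))).symm
        have hgood : IsGood a b κ β (d / L) (d % L) := by
          by_contra hng
          rw [hbad d hd' hng] at hlt
          exact lt_asymm hlt hgt
        have hk : d / L < g := Nat.div_lt_of_lt_mul (by rwa [mul_comm])
        obtain ⟨π, hπ⟩ := h.exists_reroute hk ((Nat.mod_lt d hL0).trans_eq hL.symm)
        rw [IsGood, ← hW] at hgood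
        rw [← hW] at hπ
        have heq : stepCount a b (W d) (β (d / L) + b) ℓ =
            stepCount a b (W (d + 1)) (β (d / L) + b) ℓ := by
          rw [hsucc d hd']
          exact stepCount_insert fun j hj => hπ.iterate_ne hgood (by omega)
        rcases le_total (p : ℤ) (stepCount a b (W d) (β (d / L) + b) ℓ) with hc | hc
        · have := le_rotationNumber (hC (W d) _) hclosed' hc
          push_cast at this
          rw [hpx] at this
          exact absurd (le_of_mul_le_mul_left this hℓ0) (not_le.2 hlt)
        · have := rotationNumber_le (hC (W (d + 1)) _) hclosed' (heq ▸ hc)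
          push_cast at this
          rw [hpx] at this
          exact absurd (le_of_mul_le_mul_left this hℓ0) (not_le.2 hgt)
    have hWN : W (g * L) = Set.univ := by
      ext v
      simp [hW, chainSet, Nat.mul_div_cancel _ hL0, h.lt v]
    have hfull : (p : ℤ) ≤ stepCount a b (W (g * L)) 0 ℓ := by
      simp only [hWN, stepCount, Set.mem_univ, if_true, Finset.sum_const, Finset.card_range,
        nsmul_eq_mul, mul_one, Nat.cast_le]
      exact hpℓ.le
    have := le_rotationNumber (hC (W (g * L)) 0) hclosed' hfull
    push_cast at this
    rw [hpx] at this
    exact absurd (le_of_mul_le_mul_left this hℓ0) (not_le.2 (hall _ le_rfl))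
  calc F.card ≤ ((Finset.range (g * L + 1)).image fun d => θ (W d)).card :=
        Finset.card_le_card fun x hx => Finset.mem_image.2 (hex x hx)
    _ ≤ 1 + ((Finset.range (g * L)).filter fun d => θ (W d) ≠ θ (W (d + 1))).card :=
        card_le_one_add_card_jumps _ _
    _ ≤ 1 + ((Finset.range (g * L)).filter fun d => IsGood a b κ β (d / L) (d % L)).card := by
        refine Nat.add_le_add_left (Finset.card_le_card fun d hd => ?_) 1
        rw [Finset.mem_filter, Finset.mem_range] at hd ⊢
        exact ⟨hd.1, by_contra fun hng => hd.2 (hbad d hd.1 hng)⟩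
    _ ≤ _ := Nat.add_le_add_left (card_filter_divMod_le g L (IsGood a b κ β)) 1

end CosetChain

section TriangleCount

/-- The lattice points with positive coordinates in the triangle `k (x m + y n) < m n`. -/
def trianglePoints (m n k : ℕ) : Finset (ℕ × ℕ) :=
  (Finset.range n ×ˢ Finset.range m).filter fun p =>
    0 < p.1 ∧ 0 < p.2 ∧ k * (p.1 * m + p.2 * n) < m * n

open Classical in
lemma card_filter_pos_lt_le (B : ℕ) (c : ℝ) :
    (((Finset.range B).filter fun y : ℕ => 0 < y ∧ (y : ℝ) < c).card : ℝ) ≤ max c 0 := by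
  calc _ ≤ ((Finset.Ioc 0 ⌊max c 0⌋₊).card : ℝ) := by
        refine Nat.cast_le.2 (Finset.card_le_card fun y hy => ?_)
        rw [Finset.mem_filter] at hy
        exact Finset.mem_Ioc.2 ⟨hy.2.1, Nat.le_floor (hy.2.2.le.trans (le_max_left _ _))⟩
    _ ≤ max c 0 := by
        rw [Nat.card_Ioc, Nat.sub_zero]
        exact Nat.floor_le (le_max_right _ _)

open Classical in
lemma sub_one_le_card_filter_pos_lt {B : ℕ} {c : ℝ} (hc : c ≤ B) :
    c - 1 ≤ (((Finset.range B).filter fun y : ℕ => 0 < y ∧ (y : ℝ) < c).card : ℝ) := by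
  calc c - 1 ≤ ((Finset.Ioo 0 ⌈c⌉₊).card : ℝ) := by
        rw [Nat.card_Ioo, Nat.sub_zero]
        have := Nat.le_ceil c
        have h' : (⌈c⌉₊ : ℝ) ≤ ((⌈c⌉₊ - 1 : ℕ) : ℝ) + 1 := by
          exact_mod_cast Nat.le_add_of_sub_le le_rfl
        linarith
    _ ≤ _ := by
        refine Nat.cast_le.2 (Finset.card_le_card fun y hy => ?_)
        rw [Finset.mem_Ioo] at hy
        have hy' := Nat.lt_ceil.1 hy.2
        exact Finset.mem_filter.2
          ⟨Finset.mem_range.2 (by exact_mod_cast hy'.trans_le hc), hy.1, hy'⟩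

open Classical in
lemma card_trianglePoints {m n k : ℕ} (hn : 0 < n) (hk : 0 < k) :
    (trianglePoints m n k).card = ∑ x ∈ Finset.range n, if 0 < x then
      ((Finset.range m).filter fun y : ℕ =>
        0 < y ∧ (y : ℝ) < m / n * (n / k - x)).card else 0 := by
  rw [trianglePoints, Finset.card_filter, Finset.sum_product]
  refine Finset.sum_congr rfl fun x _ => ?_
  split_ifs with hx
  · rw [Finset.card_filter]
    refine Finset.sum_congr rfl fun y _ => ?_
    have : k * (x * m + y * n) < m * n ↔ (y : ℝ) < m / n * (n / k - x) := by
      have hn' : (0 : ℝ) < n := by exact_mod_cast hn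
      have hk' : (0 : ℝ) < k := by exact_mod_cast hk
      rw [show (m : ℝ) / n * (n / k - x) = (m * n - k * (x * m)) / (k * n) by field_simp,
        lt_div_iff₀ (by positivity), ← Nat.cast_lt (α := ℝ)]
      push_cast
      constructor <;> intro h <;> linarith
    simp [hx, this]
  · simp [hx]

lemma sum_max_sub_le {X : ℝ} (hX : 0 ≤ X) (q : ℕ) :
    ∑ x ∈ Finset.range (q + 1), (if 0 < x then max (X - x) 0 else 0) ≤
      (X ^ 2 - max (X - q) 0 ^ 2) / 2 := by
  induction q with
  | zero => simp [hX]
  | succ q ih =>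
    rw [Finset.sum_range_succ, if_pos (Nat.succ_pos q)]
    push_cast
    rcases le_total (X - (q + 1)) 0 with h | h
    · rw [max_eq_right h]
      nlinarith [sq_nonneg (max (X - q) 0)]
    · rw [max_eq_left h]
      rw [max_eq_left (by linarith : (0 : ℝ) ≤ X - q)] at ih
      nlinarith

lemma sum_sub_eq (X : ℝ) (q : ℕ) :
    ∑ x ∈ Finset.range (q + 1), (if 0 < x then X - x else 0) = q * X - q * (q + 1) / 2 := by
  induction q with
  | zero => simp
  | succ q ih =>
    rw [Finset.sum_range_succ, if_pos (Nat.succ_pos q), ih]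
    push_cast
    ring

lemma card_trianglePoints_le {m n k : ℕ} (hn : 0 < n) (hk : 0 < k) :
    ((trianglePoints m n k).card : ℝ) ≤ m * n / 2 * ((k : ℝ) ^ 2)⁻¹ := by
  classical
  rw [card_trianglePoints hn hk]
  obtain ⟨q, rfl⟩ := Nat.exists_eq_succ_of_ne_zero hn.ne'
  rw [Nat.succ_eq_add_one]
  generalize hN : ((q + 1 : ℕ) : ℝ) = N
  have hN0 : 0 < N := by rw [← hN]; positivity
  have hk' : (0 : ℝ) < k := by exact_mod_cast hk
  have hm : (0 : ℝ) ≤ m / N := by positivity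
  push_cast
  calc _ ≤ ∑ x ∈ Finset.range (q + 1), m / N * (if 0 < x then max (N / k - x) 0 else 0) := by
        refine Finset.sum_le_sum fun x _ => ?_
        split_ifs
        · refine (card_filter_pos_lt_le _ _).trans ?_
          rw [mul_max_of_nonneg _ _ hm, mul_zero]
        · simp
    _ ≤ m / N * ((N / k) ^ 2 / 2) := by
        rw [← Finset.mul_sum]
        refine mul_le_mul_of_nonneg_left ((sum_max_sub_le (by positivity) q).trans ?_) hm
        linarith [sq_nonneg (max (N / k - q) 0)]
    _ = _ := by field_simp

lemma le_card_trianglePoints {m n k : ℕ} (hk : 0 < k) (hkn : k ≤ n) :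
    m * n / 2 * ((k : ℝ) ^ 2)⁻¹ - (m + n) ≤ ((trianglePoints m n k).card : ℝ) := by
  classical
  have hn : 0 < n := hk.trans_le hkn
  have hk' : (0 : ℝ) < k := by exact_mod_cast hk
  have hk1 : (1 : ℝ) ≤ k := by exact_mod_cast hk
  have hn' : (0 : ℝ) < n := by exact_mod_cast hn
  have hX1 : (1 : ℝ) ≤ n / k := (one_le_div hk').2 (by exact_mod_cast hkn)
  have hq : (((n - 1) / k : ℕ) : ℝ) ≤ n / k := by
    rw [le_div_iff₀ hk']
    exact_mod_cast (Nat.div_mul_le_self _ _).trans (Nat.sub_le _ _)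
  have hq' : (n : ℝ) / k ≤ ((n - 1) / k : ℕ) + 1 := by
    rw [div_le_iff₀ hk']
    have := Nat.lt_div_mul_add (a := n - 1) hk
    exact_mod_cast (by rw [add_mul, one_mul]; omega : n ≤ ((n - 1) / k + 1) * k)
  have hqn : (n - 1) / k < n := (Nat.div_le_self _ _).trans_lt (by omega)
  rw [card_trianglePoints hn hk]
  generalize (n - 1) / k = q at hq hq' hqn
  have hm : (0 : ℝ) ≤ m / n := by positivity
  calc (m : ℝ) * n / 2 * ((k : ℝ) ^ 2)⁻¹ - (m + n)
      ≤ m / n * ((n / k) ^ 2 / 2 - n / k) - n / k := by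
        have h1 : (m : ℝ) / k ≤ m := div_le_self (Nat.cast_nonneg m) hk1
        have h2 : (n : ℝ) / k ≤ n := div_le_self (Nat.cast_nonneg n) hk1
        have h3 : (m : ℝ) / n * ((n / k) ^ 2 / 2 - n / k) =
          m * n / 2 * ((k : ℝ) ^ 2)⁻¹ - m / k := by field_simp
        linarith
    _ ≤ m / n * (q * (n / k) - q * (q + 1) / 2) - q := by
        refine sub_le_sub (mul_le_mul_of_nonneg_left ?_ hm) hq
        nlinarith
    _ = ∑ x ∈ Finset.range (q + 1), (m / n * (if 0 < x then (n / k : ℝ) - x else 0) -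
          if 0 < x then 1 else 0) := by
        rw [Finset.sum_sub_distrib, ← Finset.mul_sum, sum_sub_eq, Finset.sum_range_succ']
        simp
    _ ≤ _ := by
        push_cast
        refine (Finset.sum_le_sum fun x _ => ?_).trans (Finset.sum_le_sum_of_subset_of_nonneg
          (Finset.range_mono hqn) fun x _ _ => by split_ifs <;> positivity)
        split_ifs with hx
        · refine sub_one_le_card_filter_pos_lt ?_
          rw [div_mul_eq_mul_div, div_le_iff₀ hn']
          refine mul_le_mul_of_nonneg_left ?_ (Nat.cast_nonneg m)
          linarith [div_le_self (Nat.cast_nonneg n) hk1, Nat.cast_nonneg (α := ℝ) x]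
        · simp

end TriangleCount

section CoprimeCount

open ArithmeticFunction in
lemma hasSum_moebius_mul_inv_sq :
    HasSum (fun d : ℕ => (moebius d : ℝ) * ((d : ℝ) ^ 2)⁻¹) (6 / Real.pi ^ 2) := by
  have h2 : 1 < (2 : ℂ).re := by norm_num
  have hs := (LSeriesSummable_moebius_iff.2 h2).LSeriesHasSum
  have hprod := LSeries_zeta_mul_Lseries_moebius h2
  rw [LSeries_zeta_eq_riemannZeta h2, riemannZeta_two] at hprod
  have hval : LSeries (fun n => (moebius n : ℂ)) 2 = ((6 / Real.pi ^ 2 : ℝ) : ℂ) := by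
    have hpi : (Real.pi : ℂ) ≠ 0 := by exact_mod_cast Real.pi_ne_zero
    push_cast
    field_simp at hprod ⊢
    linear_combination hprod
  rw [hval] at hs
  refine Complex.hasSum_ofReal.1 ?_
  rw [LSeriesHasSum] at hs
  convert hs using 2 with d
  rw [LSeries.term_def]
  split_ifs with h0
  · simp [h0]
  · push_cast
    rw [Complex.cpow_ofNat, div_eq_mul_inv]

open ArithmeticFunction in
/-- The coprime pairs among the lattice points of a triangle, by Möbius inversion. -/
lemma card_filter_coprime_trianglePoints (m n : ℕ) :
    (((trianglePoints m n 1).filter fun p => p.1.Coprime p.2).card : ℤ) =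
      ∑ d ∈ Finset.Ioc 0 n, moebius d * (trianglePoints m n d).card := by
  have hfib : ∀ d ∈ Finset.Ioc 0 n, (trianglePoints m n d).card =
      ((trianglePoints m n 1).filter fun p => d ∣ p.1 ∧ d ∣ p.2).card := by
    intro d hd
    have hd0 : 0 < d := (Finset.mem_Ioc.1 hd).1
    refine Finset.card_bij (fun p _ => (d * p.1, d * p.2)) ?_ ?_ ?_
    · rintro ⟨x, y⟩ hp
      simp only [trianglePoints, Finset.mem_filter, Finset.mem_product, Finset.mem_range] at hp ⊢
      obtain ⟨⟨hx, hy⟩, hx0, hy0, h⟩ := hp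
      have h' : d * x * m + d * y * n < m * n := by linarith [h]
      refine ⟨⟨⟨?_, ?_⟩, by positivity, by positivity, by linarith⟩, by simp, by simp⟩
      · by_contra! hc
        exact absurd h' (not_lt.2 ((mul_comm m n).trans_le
          ((Nat.mul_le_mul_right m hc).trans (Nat.le_add_right _ _))))
      · by_contra! hc
        exact absurd h' (not_lt.2 ((Nat.mul_le_mul_right n hc).trans (Nat.le_add_left _ _)))
    · rintro ⟨x, y⟩ - ⟨x', y'⟩ - h
      simpa [hd0.ne'] using h
    · rintro ⟨x, y⟩ hp
      simp only [trianglePoints, Finset.mem_filter, Finset.mem_product, Finset.mem_range] at hp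
      obtain ⟨⟨⟨hx, hy⟩, hx0, hy0, h⟩, ⟨x, rfl⟩, ⟨y, rfl⟩⟩ := hp
      refine ⟨(x, y), ?_, rfl⟩
      simp only [trianglePoints, Finset.mem_filter, Finset.mem_product, Finset.mem_range]
      exact ⟨⟨(Nat.le_mul_of_pos_left x hd0).trans_lt hx, (Nat.le_mul_of_pos_left y hd0).trans_lt hy⟩,
        Nat.pos_of_mul_pos_left hx0, Nat.pos_of_mul_pos_left hy0, by linarith⟩
  have hinv : ∀ k : ℕ, 0 < k → ∑ d ∈ k.divisors, moebius d = if k = 1 then 1 else 0 := by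
    intro k hk
    have := congrArg (fun f => f k) coe_zeta_mul_moebius
    rwa [coe_zeta_mul_apply, one_apply] at this
  calc _ = ∑ p ∈ trianglePoints m n 1, ∑ d ∈ Finset.Ioc 0 n,
        if d ∣ p.1 ∧ d ∣ p.2 then moebius d else 0 := by
        rw [Finset.card_filter, Nat.cast_sum]
        refine Finset.sum_congr rfl fun p hp => ?_
        simp only [trianglePoints, Finset.mem_filter, Finset.mem_product, Finset.mem_range] at hp
        have hpos : 0 < p.1.gcd p.2 := Nat.gcd_pos_of_pos_left _ hp.2.1
        have hle : p.1.gcd p.2 ≤ n := (Nat.gcd_le_left _ hp.2.1).trans hp.1.1.le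
        rw [← Finset.sum_filter, show ((Finset.Ioc 0 n).filter fun d => d ∣ p.1 ∧ d ∣ p.2) =
          (p.1.gcd p.2).divisors from ?_, hinv _ hpos]
        · simp [Nat.Coprime]
        · ext d
          simp only [Finset.mem_filter, Finset.mem_Ioc, Nat.mem_divisors, ← Nat.dvd_gcd_iff]
          exact ⟨fun h => ⟨h.2, hpos.ne'⟩, fun h => ⟨⟨Nat.pos_of_dvd_of_pos h.1 hpos,
            (Nat.le_of_dvd hpos h.1).trans hle⟩, h.1⟩⟩
    _ = _ := by
        rw [Finset.sum_comm]
        refine Finset.sum_congr rfl fun d hd => ?_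
        rw [hfib d hd, ← Finset.sum_filter, Finset.sum_const, nsmul_eq_mul, mul_comm]

open ArithmeticFunction Filter in
/-- The number of coprime pairs is asymptotic to `3 / π² * (m n)`. -/
lemma exists_le_card_coprime_trianglePoints :
    ∃ M : ℕ, ∀ m n : ℕ, M ≤ m → M ≤ n → (302 / 1000 : ℝ) * (m * n) ≤
      ((trianglePoints m n 1).filter fun p => p.1.Coprime p.2).card := by
  have hpi : (607 / 1000 : ℝ) < 6 / Real.pi ^ 2 := by
    rw [lt_div_iff₀ (by positivity)]
    nlinarith [Real.pi_lt_d4, Real.pi_pos]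
  obtain ⟨K, hKsum, hK⟩ := ((hasSum_moebius_mul_inv_sq.tendsto_sum_nat.comp
    (tendsto_add_atTop_nat 1)).eventually_const_lt hpi |>.and (eventually_ge_atTop 1000)).exists
  have hK' : (1000 : ℝ) ≤ K := by exact_mod_cast hK
  refine ⟨2000 * K, fun m n hm hn => ?_⟩
  have hm' : (2000 * K : ℝ) ≤ m := by exact_mod_cast hm
  have hn' : (2000 * K : ℝ) ≤ n := by exact_mod_cast hn
  have hKn : K ≤ n := by omega
  have hhead : ∑ d ∈ Finset.Ioc 0 K, ((m : ℝ) * n / 2 * (moebius d * ((d : ℝ) ^ 2)⁻¹) - (m + n)) ≤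
      ∑ d ∈ Finset.Ioc 0 K, (moebius d : ℝ) * (trianglePoints m n d).card := by
    refine Finset.sum_le_sum fun d hd => ?_
    rw [Finset.mem_Ioc] at hd
    have h1 := card_trianglePoints_le (m := m) (n := n) (by omega) hd.1
    have h2 := le_card_trianglePoints (m := m) hd.1 (hd.2.trans hKn)
    rcases moebius_eq_or d with h | h | h <;> rw [h] <;> push_cast <;>
      linarith [Nat.cast_nonneg (α := ℝ) m, Nat.cast_nonneg (α := ℝ) n]
  have htail : -∑ d ∈ Finset.Ioc K n, (m : ℝ) * n / 2 * ((d : ℝ) ^ 2)⁻¹ ≤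
      ∑ d ∈ Finset.Ioc K n, (moebius d : ℝ) * (trianglePoints m n d).card := by
    rw [← Finset.sum_neg_distrib]
    refine Finset.sum_le_sum fun d hd => ?_
    rw [Finset.mem_Ioc] at hd
    have h1 := card_trianglePoints_le (m := m) (n := n) (k := d) (by omega) (by omega)
    have h2 : (0 : ℝ) ≤ m * n / 2 * ((d : ℝ) ^ 2)⁻¹ := by positivity
    rcases moebius_eq_or d with h | h | h <;> rw [h] <;> push_cast <;>
      linarith [Nat.cast_nonneg (α := ℝ) (trianglePoints m n d).card]
  rw [← Finset.mul_sum] at htail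
  rw [Finset.sum_sub_distrib, ← Finset.mul_sum, Finset.sum_const, Nat.card_Ioc, nsmul_eq_mul,
    Nat.sub_zero] at hhead
  have hcard : (((trianglePoints m n 1).filter fun p => p.1.Coprime p.2).card : ℝ) =
      ∑ d ∈ Finset.Ioc 0 K, (moebius d : ℝ) * (trianglePoints m n d).card +
        ∑ d ∈ Finset.Ioc K n, (moebius d : ℝ) * (trianglePoints m n d).card := by
    rw [Finset.sum_Ioc_consecutive _ (Nat.zero_le K) hKn]
    exact_mod_cast card_filter_coprime_trianglePoints m n
  have hinv : (K : ℝ)⁻¹ ≤ 1 / 1000 := by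
    rw [inv_le_comm₀ (by linarith) (by norm_num)]
    simpa using hK'
  have hsum : ∑ d ∈ Finset.Ioc K n, ((d : ℝ) ^ 2)⁻¹ ≤ 1 / 1000 := by
    have := sum_Ioc_inv_sq_le_sub (α := ℝ) (by omega : K ≠ 0) hKn
    have h0 : (0 : ℝ) ≤ (n : ℝ)⁻¹ := by positivity
    linarith
  have hKsum' : (607 / 1000 : ℝ) < ∑ d ∈ Finset.Ioc 0 K, (moebius d : ℝ) * ((d : ℝ) ^ 2)⁻¹ := by
    refine hKsum.trans_eq ?_
    rw [Function.comp_apply, Finset.range_eq_Ico, Finset.sum_eq_sum_Ico_succ_bot K.succ_pos]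
    simp only [ArithmeticFunction.map_zero, Int.cast_zero, zero_mul, zero_add]
    rfl
  have e1 := mul_le_mul_of_nonneg_left hsum (by positivity : (0 : ℝ) ≤ (m : ℝ) * n / 2)
  have e2 := mul_le_mul_of_nonneg_left hKsum'.le (by positivity : (0 : ℝ) ≤ (m : ℝ) * n / 2)
  have e3 : (K : ℝ) * (m + n) ≤ m * n / 1000 := by
    nlinarith
  linarith

end CoprimeCount

section ArcDisjointPairs

variable {G : Type*} [AddCommGroup G] {a b δ : G} {g : ℕ} {κ : G → ℕ} {β : ℕ → G} {k r : ℕ}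

lemma IsCosetChain.ncard_chainSet [Finite G] (h : IsCosetChain δ g κ β) (hk : k < g)
    (hr : r < addOrderOf δ) : (chainSet δ κ β k r).ncard = k * addOrderOf δ + r := by
  have hL0 : 0 < addOrderOf δ := addOrderOf_pos δ
  have key : ∀ d < g * addOrderOf δ,
      (chainSet δ κ β (d / addOrderOf δ) (d % addOrderOf δ)).ncard = d := by
    intro d
    induction d with
    | zero => intro _; simp [chainSet]
    | succ d ih =>
      intro hd
      have hdk : d / addOrderOf δ < g :=
        Nat.div_lt_of_lt_mul (by rw [mul_comm]; exact (Nat.lt_succ_self d).trans hd)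
      rw [h.chainSet_divMod_succ rfl ((Nat.lt_succ_self d).trans hd), Set.ncard_insert_of_notMem,
        ih ((Nat.lt_succ_self d).trans hd)]
      rw [h.add_mem_chainSet_iff hdk (Nat.mod_lt d hL0).le (Nat.mod_lt d hL0)]
      exact lt_irrefl _
  have := key (addOrderOf δ * k + r) (by nlinarith)
  rwa [Nat.mul_add_div hL0, Nat.mul_add_mod, Nat.div_eq_of_lt hr, Nat.mod_eq_of_lt hr, add_zero,
    mul_comm] at this

/-- A path that arises from the chain determines the chain data and the translation. -/
lemma IsCosetChain.eq_of_realizes [Finite G] (h : IsCosetChain (a - b) g κ β) (hab : a ≠ b)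
    {N : ℕ} (hN : 0 < N) {p : Fin N → G} {k' r' : ℕ} {t t' : G} (hk : k < g) (hk' : k' < g)
    (hr : r < addOrderOf (a - b)) (hr' : r' < addOrderOf (a - b))
    (hp : Realizes a b N p {v | v - t ∈ chainSet (a - b) κ β k r}
      (β k + r • (a - b) + t) (β k + b + t))
    (hp' : Realizes a b N p {v | v - t' ∈ chainSet (a - b) κ β k' r'}
      (β k' + r' • (a - b) + t') (β k' + b + t')) :
    k = k' ∧ r = r' ∧ t = t' := by
  have hncard : ∀ (W : Set G) (t : G), {v | v - t ∈ W}.ncard = W.ncard := fun W t => by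
    rw [← Set.ncard_image_of_injective W (add_left_injective t)]
    congr 1
    ext v
    simp [sub_eq_add_neg]
  have hmem : ∀ {W : Set G} {τ ι : G}, Realizes a b N p W τ ι → W = {v | (v, v + a) ∈ ArcSet N p} :=
    fun hW => by ext v; simp [hW.mem_arcSet, hab]
  have hcard : k * addOrderOf (a - b) + r = k' * addOrderOf (a - b) + r' := by
    rw [← h.ncard_chainSet hk hr, ← h.ncard_chainSet hk' hr', ← hncard (chainSet _ _ _ k r) t,
      ← hncard (chainSet _ _ _ k' r') t', hmem hp, ← hmem hp']
  have hkk : k = k' := by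
    have := congrArg (· / addOrderOf (a - b)) hcard
    simpa [Nat.mul_add_div (addOrderOf_pos (a - b)), mul_comm _ (addOrderOf (a - b)),
      Nat.div_eq_of_lt hr, Nat.div_eq_of_lt hr'] using this
  subst hkk
  refine ⟨rfl, by omega, ?_⟩
  exact add_left_cancel ((hp.first hN).symm.trans (hp'.first hN))

/-- A path of the chain and a suitable translate of a path of the reversed chain are
arc-disjoint. -/
lemma IsCosetChain.disjoint_arcSet [Finite G] (h : IsCosetChain (a - b) g κ β) (hab : a ≠ b)
    {N : ℕ} {p q : Fin N → G} {s r' : ℕ} {τ ι ι' : G} (hk : k < g) (hs : s ≤ 1)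
    (hle : r + r' + s ≤ addOrderOf (a - b)) (hge : addOrderOf (a - b) ≤ r + r' + s + 1)
    (hτ : τ = β k + r • (a - b))
    (hp : Realizes a b N p (chainSet (a - b) κ β k r) τ ι)
    (hq : Realizes a b N q {v | v - (r + s) • (a - b) ∈
        chainSet (a - b) (fun v => g - 1 - κ v) (fun k => β (g - 1 - k)) (g - 1 - k) r'}
      (β k + r' • (a - b) + (r + s) • (a - b)) ι') :
    Disjoint (ArcSet N p) (ArcSet N q) := by
  have hrev : ∀ v, v - (r + s) • (a - b) ∈
        chainSet (a - b) (fun v => g - 1 - κ v) (fun k => β (g - 1 - k)) (g - 1 - k) r' ↔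
      k < κ v ∨ ∃ j < r', v = β k + (r + s + j) • (a - b) := fun v => by
    have h1 := h.lt v
    have h2 : κ (v - (r + s) • (a - b)) = κ v := by
      have := h.add_nsmul (v - (r + s) • (a - b)) (r + s)
      rwa [sub_add_cancel, eq_comm] at this
    simp only [chainSet, Set.mem_ofPred_eq, h2, show g - 1 - (g - 1 - k) = k by omega,
      sub_eq_iff_eq_add]
    refine or_congr (by omega) (exists_congr fun j => and_congr_right fun _ => ?_)
    rw [show β k + j • (a - b) + (r + s) • (a - b) = β k + (r + s + j) • (a - b) by module]
  rw [Set.disjoint_left]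
  intro e he he'
  rw [hp.mem_arcSet] at he
  rw [hq.mem_arcSet, Set.mem_ofPred_eq, hrev] at he'
  rcases he with ⟨h1, h2⟩ | ⟨h1, h2, h3⟩ <;> rcases he' with ⟨h4, h5⟩ | ⟨h4, h5, h6⟩
  · rcases h1 with h1 | ⟨j, hj, h1⟩ <;> rcases h4 with h4 | ⟨i, hi, h4⟩
    · omega
    · rw [h4, h.add_nsmul, h.base k hk] at h1
      exact lt_irrefl _ h1
    · rw [h1, h.add_nsmul, h.base k hk] at h4
      exact lt_irrefl _ h4
    · rw [h1, add_right_inj, nsmul_eq_nsmul_iff_of_lt (by omega) (by omega)] at h4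
      omega
  · rw [h2, add_right_inj] at h6
    exact hab h6
  · rw [h5, add_right_inj] at h3
    exact hab h3
  · push Not at h4
    have hκ : κ e.1 = k := le_antisymm h4.1 (not_lt.1 fun hlt => h1 (Or.inl hlt))
    obtain ⟨j, hj, hej⟩ := h.exists_eq e.1
    rw [hκ] at hej
    have hjr : r < j := by
      rcases lt_trichotomy j r with hlt | rfl | hlt
      · exact absurd (Or.inr ⟨j, hlt, hej⟩) h1
      · exact absurd (hej.trans hτ.symm) h2
      · exact hlt
    obtain ⟨i, rfl⟩ := Nat.exists_eq_add_of_le (show r + s ≤ j by omega)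
    have hir : r' ≤ i := not_lt.1 fun hlt => h4.2 i hlt hej
    rcases hir.eq_or_lt with rfl | hlt
    · exact h5 (hej.trans (by module))
    · omega

end ArcDisjointPairs

section ParityCount

lemma two_mul_card_le_of_parity {S : Finset ℕ} {n : ℕ} (hn : ∀ x ∈ S, x < n)
    (hS : ∀ x ∈ S, ∀ y ∈ S, x % 2 = y % 2) : 2 * S.card ≤ n + 1 := by
  have : S.card ≤ (Finset.range ((n + 1) / 2)).card := by
    refine Finset.card_le_card_of_injOn (· / 2) (fun x hx => ?_) fun x hx y hy hxy => ?_
    · have := hn x hx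
      simp only [Finset.coe_range, Set.mem_Iio]
      omega
    · have := hS x hx y hy
      simp only at hxy
      omega
  rw [Finset.card_range] at this
  omega

/-- Two subsets of `{0, …, L - 1}`, each contained in a parity class, have many pairs of elements
with sum `L - s - 1` or `L - s`. -/
lemma two_mul_card_add_card_le {A B : Finset ℕ} {L s : ℕ} (hL : 2 ≤ L) (hs : s ≤ 1)
    (hA : ∀ x ∈ A, x < L) (hB : ∀ x ∈ B, x < L)
    (hA' : ∀ x ∈ A, ∀ y ∈ A, x % 2 = y % 2) (hB' : ∀ x ∈ B, ∀ y ∈ B, x % 2 = y % 2) :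
    2 * (A.card + B.card) ≤
      2 * ((A ×ˢ B).filter fun p => p.1 + p.2 + s ≤ L ∧ L ≤ p.1 + p.2 + s + 1).card + L + 3 := by
  have hcardA := two_mul_card_le_of_parity hA hA'
  have hcardB := two_mul_card_le_of_parity hB hB'
  rcases A.eq_empty_or_nonempty with rfl | ⟨x₀, hx₀⟩
  · simp only [Finset.card_empty]; omega
  rcases B.eq_empty_or_nonempty with rfl | ⟨y₀, hy₀⟩
  · simp only [Finset.card_empty]; omega
  obtain ⟨c, hc, hpar⟩ : ∃ c, (c + s + 1 = L ∨ c + s = L) ∧ (x₀ + y₀) % 2 = c % 2 := by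
    by_cases hp : (x₀ + y₀) % 2 = (L - s) % 2
    · exact ⟨L - s, by omega, hp⟩
    · exact ⟨L - s - 1, by omega, by omega⟩
  have hsumA : (A.image (· + 1)).card = A.card :=
    Finset.card_image_of_injective _ (add_left_injective 1)
  have hsumB : (B.image (c + 1 - ·)).card = B.card := by
    refine Finset.card_image_of_injOn fun x hx y hy hxy => ?_
    have := hB x hx
    have := hB y hy
    omega
  have hunion : 2 * (A.image (· + 1) ∪ B.image (c + 1 - ·)).card ≤ (L + 2) + 1 := by
    have hmem : ∀ z ∈ A.image (· + 1) ∪ B.image (c + 1 - ·),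
        z < L + 2 ∧ z % 2 = (x₀ + 1) % 2 := by
      intro z hz
      rw [Finset.mem_union, Finset.mem_image, Finset.mem_image] at hz
      rcases hz with ⟨x, hx, rfl⟩ | ⟨y, hy, rfl⟩
      · have := hA x hx
        have := hA' x hx x₀ hx₀
        omega
      · have := hB y hy
        have := hB' y hy y₀ hy₀
        omega
    exact two_mul_card_le_of_parity (fun z hz => (hmem z hz).1)
      fun z hz w hw => (hmem z hz).2.trans (hmem w hw).2.symm
  have hinter : (A.image (· + 1) ∩ B.image (c + 1 - ·)).card ≤
      ((A ×ˢ B).filter fun p => p.1 + p.2 + s ≤ L ∧ L ≤ p.1 + p.2 + s + 1).card := by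
    refine Finset.card_le_card_of_injOn (fun z => (z - 1, c + 1 - z)) (fun z hz => ?_)
      fun z hz w hw hzw => ?_
    · rw [Finset.mem_coe, Finset.mem_inter, Finset.mem_image, Finset.mem_image] at hz
      obtain ⟨⟨x, hx, rfl⟩, y, hy, hxy⟩ := hz
      have := hB y hy
      simp only [Finset.coe_filter, Finset.mem_product, Set.mem_ofPred_eq, Nat.add_sub_cancel]
      rw [show c + 1 - (x + 1) = y by omega]
      exact ⟨⟨hx, hy⟩, by omega, by omega⟩
    · rw [Finset.mem_coe, Finset.mem_inter, Finset.mem_image] at hz hw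
      obtain ⟨⟨x, -, rfl⟩, -⟩ := hz
      obtain ⟨⟨y, -, rfl⟩, -⟩ := hw
      simpa using congrArg Prod.fst hzw
  have := Finset.card_union_add_card_inter (A.image (· + 1)) (B.image (c + 1 - ·))
  omega

end ParityCount

section PairCount

variable {G : Type*} [AddCommGroup G] {a b δ : G} {g : ℕ} {κ : G → ℕ} {β : ℕ → G}

/-- The pairs `((r, r'), s)` for which the path of the chain at `(k, r)` and a translate of the path
of the reversed chain at `(g - 1 - k, r')` are arc-disjoint, and `s` is the offset between the end
of the former and the start of the latter. -/
noncomputable def pairData (a b : G) (g : ℕ) (κ : G → ℕ) (β : ℕ → G) (k : ℕ) :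
    Finset ((ℕ × ℕ) × ℕ) :=
  ((goodPositions a b κ β k ×ˢ goodPositions a b (fun v => g - 1 - κ v)
    (fun k => β (g - 1 - k)) (g - 1 - k)) ×ˢ Finset.range 2).filter fun x =>
      x.1.1 + x.1.2 + x.2 ≤ addOrderOf (a - b) ∧ addOrderOf (a - b) ≤ x.1.1 + x.1.2 + x.2 + 1

lemma mem_pairData {k r r' s : ℕ} :
    ((r, r'), s) ∈ pairData a b g κ β k ↔ (((r < addOrderOf (a - b) ∧ IsGood a b κ β k r) ∧
      r' < addOrderOf (a - b) ∧
        IsGood a b (fun v => g - 1 - κ v) (fun k => β (g - 1 - k)) (g - 1 - k) r') ∧ s < 2) ∧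
      r + r' + s ≤ addOrderOf (a - b) ∧ addOrderOf (a - b) ≤ r + r' + s + 1 := by
  simp [pairData, mem_goodPositions]

lemma two_le_addOrderOf [Finite G] (hab : a ≠ b) : 2 ≤ addOrderOf (a - b) := by
  have h0 := addOrderOf_pos (a - b)
  have h1 : addOrderOf (a - b) ≠ 1 := by rwa [Ne, AddMonoid.addOrderOf_eq_one_iff, sub_eq_zero]
  omega

lemma IsCosetChain.two_mul_card_goodPositions_le [Finite G] (h : IsCosetChain (a - b) g κ β)
    (hab : a ≠ b) {k : ℕ} (hk : k < g) :
    2 * (goodPositions a b κ β k).card + 2 * (goodPositions a b (fun v => g - 1 - κ v)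
      (fun k => β (g - 1 - k)) (g - 1 - k)).card ≤
      (pairData a b g κ β k).card + addOrderOf (a - b) + 3 := by
  have : Nontrivial G := ⟨a, b, hab⟩
  have key : ∀ s ≤ 1, _ := fun s hs => two_mul_card_add_card_le (two_le_addOrderOf hab) hs
    (fun x hx => (mem_goodPositions.1 hx).1) (fun x hx => (mem_goodPositions.1 hx).1)
    (fun x hx y hy => h.parity_eq hk (mem_goodPositions.1 hx).1 (mem_goodPositions.1 hy).1
      (mem_goodPositions.1 hx).2 (mem_goodPositions.1 hy).2)
    (fun x hx y hy => h.reverse.parity_eq (k := g - 1 - k) (by omega) (mem_goodPositions.1 hx).1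
      (mem_goodPositions.1 hy).1 (mem_goodPositions.1 hx).2 (mem_goodPositions.1 hy).2)
  have hcard := key 0 zero_le_one
  have hcard' := key 1 le_rfl
  simp only [Finset.card_filter] at hcard hcard'
  rw [pairData, Finset.card_filter, Finset.sum_product_right, Finset.sum_range_succ,
    Finset.sum_range_one]
  dsimp only
  omega

/-- Arc-disjoint hamiltonian paths. -/
def IsArcDisjointPair (a b : G) (N : ℕ) (P : (Fin N → G) × (Fin N → G)) : Prop :=
  IsHamPath a b N P.1 ∧ IsHamPath a b N P.2 ∧ Disjoint (ArcSet N P.1) (ArcSet N P.2)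

lemma IsCosetChain.exists_isArcDisjointPair [Fintype G] (h : IsCosetChain (a - b) g κ β)
    (hab : a ≠ b) {k r r' s : ℕ} (hk : k < g) (hx : ((r, r'), s) ∈ pairData a b g κ β k) (t : G) :
    ∃ P : (Fin (Fintype.card G) → G) × (Fin (Fintype.card G) → G),
      IsArcDisjointPair a b (Fintype.card G) P ∧
      Realizes a b (Fintype.card G) P.1 {v | v - t ∈ chainSet (a - b) κ β k r}
        (β k + r • (a - b) + t) (β k + b + t) ∧
      Realizes a b (Fintype.card G) P.2
        {v | v - ((r + s) • (a - b) + t) ∈ chainSet (a - b) (fun v => g - 1 - κ v)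
          (fun k => β (g - 1 - k)) (g - 1 - k) r'}
        (β (g - 1 - (g - 1 - k)) + r' • (a - b) + ((r + s) • (a - b) + t))
        (β (g - 1 - (g - 1 - k)) + b + ((r + s) • (a - b) + t)) := by
  obtain ⟨⟨⟨⟨hr, hgood⟩, hr', hgood'⟩, hs⟩, hle, hge⟩ := mem_pairData.1 hx
  obtain ⟨π, hπ⟩ := h.exists_reroute hk hr
  obtain ⟨p, hp⟩ := hπ.exists_realizes hgood
  obtain ⟨π', hπ'⟩ := h.reverse.exists_reroute (k := g - 1 - k) (by omega) hr'
  obtain ⟨q, hq⟩ := hπ'.exists_realizes hgood'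
  have hqt := hq.translate ((r + s) • (a - b))
  rw [show g - 1 - (g - 1 - k) = k by omega] at hqt
  have hdisj := disjoint_arcSet_translate (h.disjoint_arcSet hab hk (by omega) hle hge rfl hp hqt) t
  simp only [add_assoc] at hdisj
  exact ⟨(fun i => p i + t, fun i => q i + ((r + s) • (a - b) + t)),
    ⟨(hp.translate t).isHamPath, (hq.translate _).isHamPath, hdisj⟩, hp.translate t, hq.translate _⟩

lemma IsCosetChain.card_mul_sum_card_pairData_le [Fintype G] (h : IsCosetChain (a - b) g κ β)
    (hab : a ≠ b) :
    Fintype.card G * ∑ k ∈ Finset.range g, (pairData a b g κ β k).card ≤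
      Nat.card {P // IsArcDisjointPair a b (Fintype.card G) P} := by
  classical
  have hN : 0 < Fintype.card G := Fintype.card_pos
  have hex : ∀ x : G × {y // y ∈ (Finset.range g).sigma (pairData a b g κ β)}, _ := fun x =>
    h.exists_isArcDisjointPair hab (Finset.mem_range.1 (Finset.mem_sigma.1 x.2.2).1)
      (Finset.mem_sigma.1 x.2.2).2 x.1
  choose f hf hp hq using hex
  rw [← Finset.card_sigma, ← Fintype.card_coe, ← Fintype.card_prod, ← Nat.card_eq_fintype_card]
  refine Nat.card_le_card_of_injective (fun x => ⟨f x, hf x⟩) fun x x' hxx => ?_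
  obtain ⟨t, ⟨k, ⟨r, r'⟩, s⟩, hx⟩ := x
  obtain ⟨t', ⟨k', ⟨r₁, r₁'⟩, s'⟩, hx'⟩ := x'
  have hff := congrArg Subtype.val hxx
  simp only at hff
  have hp₁ := hp (t, ⟨⟨k, ⟨r, r'⟩, s⟩, hx⟩)
  have hq₁ := hq (t, ⟨⟨k, ⟨r, r'⟩, s⟩, hx⟩)
  rw [hff] at hp₁ hq₁
  rw [Finset.mem_sigma, Finset.mem_range] at hx hx'
  obtain ⟨hk, hx⟩ := hx
  obtain ⟨hk', hx'⟩ := hx'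
  have hd := mem_pairData.1 hx
  have hd' := mem_pairData.1 hx'
  simp only at hk hk'
  obtain ⟨rfl, rfl, rfl⟩ := h.eq_of_realizes hab hN hk hk' hd.1.1.1.1 hd'.1.1.1.1 hp₁
    (hp (t', ⟨⟨k', ⟨r₁, r₁'⟩, s'⟩, _⟩))
  obtain ⟨-, rfl, hss⟩ := h.reverse.eq_of_realizes hab hN (by omega) (by omega)
    hd.1.1.2.1 hd'.1.1.2.1 hq₁ (hq (t, ⟨⟨k, ⟨r, r₁'⟩, s'⟩, _⟩))
  have hL := two_le_addOrderOf (a := a) (b := b) hab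
  simp only [add_left_inj, add_smul, add_right_inj] at hss
  rw [nsmul_eq_nsmul_iff_of_lt (by omega) (by omega)] at hss
  subst hss
  rfl

lemma IsCosetChain.card_mul_card_slopes_le [Fintype G] (h : IsCosetChain (a - b) g κ β)
    (hab : a ≠ b) (hgen : ∀ v : G, ∃ i : ℕ, ∃ j : ℤ, v = i • b + j • (a - b))
    (hcard : g * addOrderOf (a - b) = Fintype.card G) (F : Finset ℝ)
    (hF : ∀ x ∈ F, ∃ ℓ p : ℕ, 0 < p ∧ p < ℓ ∧ ℓ < Fintype.card G ∧
      ℓ • b + p • (a - b) = 0 ∧ (p : ℝ) = ℓ * x) :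
    Fintype.card G * (4 * F.card) ≤ Fintype.card G * (4 + Fintype.card G + 3 * g) +
      Nat.card {P // IsArcDisjointPair a b (Fintype.card G) P} := by
  have hgood := h.card_le_one_add_card_good hgen hcard F hF
  have hgood' := h.reverse.card_le_one_add_card_good hgen hcard F hF
  rw [← Finset.sum_range_reflect] at hgood'
  have hsum := Finset.sum_le_sum fun k hk =>
    h.two_mul_card_goodPositions_le hab (Finset.mem_range.1 hk)
  simp only [Finset.sum_add_distrib, ← Finset.mul_sum, Finset.sum_const, Finset.card_range,
    smul_eq_mul, hcard] at hsum
  have hle : 4 * F.card ≤ (4 + Fintype.card G + 3 * g) +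
      ∑ k ∈ Finset.range g, (pairData a b g κ β k).card := by
    omega
  calc _ ≤ _ := Nat.mul_le_mul_left _ hle
    _ ≤ _ := by
      rw [mul_add]
      exact Nat.add_le_add_left (h.card_mul_sum_card_pairData_le hab) _

/-- Each unordered pair comes from at most two ordered pairs. -/
lemma card_isArcDisjointPair_le [Finite G] {N : ℕ} (hN : 2 ≤ N) :
    Nat.card {P // IsArcDisjointPair a b N P} ≤
      2 * Nat.card {S : Set (Fin N → G) // ∃ v v' : Fin N → G, v ≠ v' ∧ S = {v, v'} ∧
        IsHamPath a b N v ∧ IsHamPath a b N v' ∧ Disjoint (ArcSet N v) (ArcSet N v')} := by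
  have hex : ∀ S : {S : Set (Fin N → G) // ∃ v v' : Fin N → G, v ≠ v' ∧ S = {v, v'} ∧
      IsHamPath a b N v ∧ IsHamPath a b N v' ∧ Disjoint (ArcSet N v) (ArcSet N v')}, _ := fun S => S.2
  choose v v' hne hS hv hv' hd using hex
  rw [mul_comm, ← Fintype.card_bool, ← Nat.card_eq_fintype_card, ← Nat.card_prod]
  refine Nat.card_le_card_of_surjective
    (fun x => if x.2 then ⟨(v x.1, v' x.1), hv _, hv' _, hd _⟩
      else ⟨(v' x.1, v x.1), hv' _, hv _, (hd _).symm⟩) ?_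
  rintro ⟨⟨w, w'⟩, hw, hw', hww⟩
  have hne' : w ≠ w' := by
    rintro rfl
    exact Set.disjoint_left.1 hww ⟨0, hN, rfl⟩ ⟨0, hN, rfl⟩
  have hpair := hS ⟨{w, w'}, w, w', hne', rfl, hw, hw', hww⟩
  rcases Set.pair_eq_pair_iff.1 hpair with ⟨h1, h2⟩ | ⟨h1, h2⟩
  · exact ⟨(⟨{w, w'}, w, w', hne', rfl, hw, hw', hww⟩, true), by simp [← h1, ← h2]⟩
  · exact ⟨(⟨{w, w'}, w, w', hne', rfl, hw, hw', hww⟩, false), by simp [← h1, ← h2]⟩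

end PairCount

section Torus

lemma exists_isCosetChain {G : Type*} [AddCommGroup G] [Finite G] (δ : G) :
    ∃ g κ β, IsCosetChain δ g κ β ∧ g * addOrderOf δ = Nat.card G := by
  classical
  let e := Finite.equivFin (G ⧸ AddSubgroup.zmultiples δ)
  have hβ : ∀ k (hk : k < Nat.card (G ⧸ AddSubgroup.zmultiples δ)),
      (QuotientAddGroup.mk (e.symm ⟨k, hk⟩).out : G ⧸ AddSubgroup.zmultiples δ) = e.symm ⟨k, hk⟩ :=
    fun k hk => Quotient.out_eq' _
  refine ⟨Nat.card (G ⧸ AddSubgroup.zmultiples δ), fun v => e (QuotientAddGroup.mk v),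
    fun k => if hk : k < Nat.card (G ⧸ AddSubgroup.zmultiples δ) then (e.symm ⟨k, hk⟩).out else 0,
    ⟨fun v => (e _).2, fun v j => ?_, fun k hk => ?_, fun v => ?_⟩, ?_⟩
  · rw [QuotientAddGroup.mk_add_of_mem]
    exact AddSubgroup.mem_zmultiples_iff.2 ⟨j, rfl⟩
  · simp only [hk, dite_true]
    rw [hβ, Equiv.apply_symm_apply]
  · have hv := hβ _ (e (QuotientAddGroup.mk v)).2
    rw [Fin.eta, Equiv.symm_apply_apply, QuotientAddGroup.eq,
      mem_zmultiples_iff_mem_range_addOrderOf, Finset.mem_image] at hv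
    obtain ⟨j, hj, hjv⟩ := hv
    refine ⟨j, Finset.mem_range.1 hj, ?_⟩
    simp only [Fin.is_lt, dite_true, Fin.eta, Equiv.symm_apply_apply, hjv, add_neg_cancel_left]
  · rw [AddSubgroup.card_eq_card_quotient_mul_card_addSubgroup (AddSubgroup.zmultiples δ),
      Nat.card_zmultiples]

lemma injOn_slope {m n : ℕ} (hm : 0 < m) (hn : 0 < n) :
    Set.InjOn (fun p : ℕ × ℕ => (p.1 * m : ℝ) / (p.1 * m + p.2 * n))
      {p | 0 < p.1 ∧ 0 < p.2 ∧ p.1.Coprime p.2} := by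
  rintro ⟨x, y⟩ ⟨hx, hy, hxy⟩ ⟨x', y'⟩ ⟨hx', hy', hxy'⟩ h
  simp only at *
  have hm' : (0 : ℝ) < m := by exact_mod_cast hm
  have hn' : (0 : ℝ) < n := by exact_mod_cast hn
  have h1 : (0 : ℝ) < x := by exact_mod_cast hx
  have h2 : (0 : ℝ) < y := by exact_mod_cast hy
  have h1' : (0 : ℝ) < x' := by exact_mod_cast hx'
  have h2' : (0 : ℝ) < y' := by exact_mod_cast hy'
  rw [div_eq_div_iff (by positivity) (by positivity)] at h
  have hcross : x * y' = x' * y := by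
    have : (m * n : ℝ) * (x * y') = (m * n) * (x' * y) := by linear_combination h
    exact_mod_cast mul_left_cancel₀ (by positivity) this
  have hxx : x = x' := Nat.dvd_antisymm
    (hxy.dvd_of_dvd_mul_right (Dvd.intro _ hcross))
    (hxy'.dvd_of_dvd_mul_right (Dvd.intro _ hcross.symm))
  subst hxx
  exact Prod.ext rfl (Nat.eq_of_mul_eq_mul_left hx hcross.symm)

/-- The slopes of the closed walks of `ZMod m × ZMod n` shorter than a hamiltonian cycle. -/
noncomputable def slopes (m n : ℕ) : Finset ℝ :=
  ((trianglePoints m n 1).filter fun p => p.1.Coprime p.2).image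
    fun p : ℕ × ℕ => (p.1 * m : ℝ) / (p.1 * m + p.2 * n)

lemma card_slopes {m n : ℕ} (hm : 0 < m) (hn : 0 < n) :
    (slopes m n).card = ((trianglePoints m n 1).filter fun p => p.1.Coprime p.2).card :=
  Finset.card_image_of_injOn <| (injOn_slope hm hn).mono fun p hp => by
    rw [Finset.mem_coe, Finset.mem_filter, trianglePoints, Finset.mem_filter] at hp
    exact ⟨hp.1.2.1, hp.1.2.2.1, hp.2⟩

lemma exists_closed_of_mem_slopes {m n : ℕ} (hm : 0 < m) (hn : 0 < n) {z : ℝ}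
    (hz : z ∈ slopes m n) : ∃ ℓ p : ℕ, 0 < p ∧ p < ℓ ∧ ℓ < m * n ∧
      ℓ • ((0, 1) : ZMod m × ZMod n) + p • ((1, 0) - (0, 1)) = 0 ∧ (p : ℝ) = ℓ * z := by
  rw [slopes, Finset.mem_image] at hz
  obtain ⟨⟨x, y⟩, hp, rfl⟩ := hz
  rw [Finset.mem_filter, trianglePoints, Finset.mem_filter] at hp
  obtain ⟨⟨-, hx, hy, hlt⟩, -⟩ := hp
  simp only at hx hy hlt
  have hx' : 0 < x * m := by positivity
  have hy' : 0 < y * n := by positivity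
  refine ⟨x * m + y * n, x * m, hx', by omega, by omega, ?_, ?_⟩
  · ext <;> simp
  · have : ((x * m + y * n : ℕ) : ℝ) ≠ 0 := by positivity
    push_cast at this ⊢
    field_simp

lemma exists_eq_nsmul_add_zsmul {m n : ℕ} [NeZero n] (v : ZMod m × ZMod n) :
    ∃ i : ℕ, ∃ j : ℤ, v = i • ((0, 1) : ZMod m × ZMod n) + j • ((1, 0) - (0, 1)) := by
  obtain ⟨j, hj⟩ := ZMod.intCast_surjective v.1
  refine ⟨(v.2 + j).val, j, ?_⟩
  ext <;> simp [hj]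

lemma dvd_addOrderOf {m n : ℕ} :
    m ∣ addOrderOf ((1, 0) - (0, 1) : ZMod m × ZMod n) := by
  have := congrArg Prod.fst (addOrderOf_nsmul_eq_zero ((1, 0) - (0, 1) : ZMod m × ZMod n))
  simpa [ZMod.natCast_eq_zero_iff] using this

lemma mul_card_slopes_le {m n : ℕ} (hm : 2 ≤ m) (hn : 0 < n) :
    (m * n) * (4 * (slopes m n).card) ≤ (m * n) * (4 + m * n + 3 * n) +
      Nat.card {P // IsArcDisjointPair ((1, 0) : ZMod m × ZMod n) (0, 1) (m * n) P} := by
  have : NeZero m := ⟨by omega⟩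
  have : NeZero n := ⟨by omega⟩
  have : Fact (1 < m) := ⟨hm⟩
  have hN : Fintype.card (ZMod m × ZMod n) = m * n := by simp [ZMod.card]
  obtain ⟨g, κ, β, h, hcard⟩ := exists_isCosetChain ((1, 0) - (0, 1) : ZMod m × ZMod n)
  rw [Nat.card_eq_fintype_card] at hcard
  have hgn : g ≤ n := by
    have h1 := Nat.le_of_dvd (addOrderOf_pos _) (dvd_addOrderOf (m := m) (n := n))
    have h2 : g * m ≤ n * m := by
      rw [mul_comm n m, ← hN, ← hcard]
      exact Nat.mul_le_mul_left g h1
    exact Nat.le_of_mul_le_mul_right h2 (by omega)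
  have hmain := h.card_mul_card_slopes_le (by simp [Prod.ext_iff]) exists_eq_nsmul_add_zsmul hcard
    (slopes m n) (by rw [hN]; exact fun z hz => exists_closed_of_mem_slopes (by omega) hn hz)
  rw [hN] at hmain
  refine hmain.trans (Nat.add_le_add_right (Nat.mul_le_mul_left _ ?_) _)
  omega

end Torus

/-- There is an `M` such that for all `m, n ≥ M`, the number of unordered pairs of
arc-disjoint hamiltonian paths in `Cay(ℤ_m × ℤ_n; e₁, e₂)` is greater than `m²n²/10`. -/
theorem many_pairs_arc_disjoint_hamiltonian_paths :
    ∃ M : ℕ, ∀ m n : ℕ, M ≤ m → M ≤ n →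
      m ^ 2 * n ^ 2 <
        10 * Nat.card {S : Set (Fin (m * n) → ZMod m × ZMod n) //
          ∃ v v' : Fin (m * n) → ZMod m × ZMod n, v ≠ v' ∧ S = {v, v'} ∧
            IsHamPath ((1, 0) : ZMod m × ZMod n) ((0, 1) : ZMod m × ZMod n) (m * n) v ∧
            IsHamPath ((1, 0) : ZMod m × ZMod n) ((0, 1) : ZMod m × ZMod n) (m * n) v' ∧
            Disjoint (ArcSet (m * n) v) (ArcSet (m * n) v')} := by
  obtain ⟨M, hM⟩ := exists_le_card_coprime_trianglePoints
  refine ⟨max M 1000, fun m n hm hn => ?_⟩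
  obtain ⟨hm, hm'⟩ := max_le_iff.1 hm
  obtain ⟨hn, hn'⟩ := max_le_iff.1 hn
  have : NeZero m := ⟨by omega⟩
  have : NeZero n := ⟨by omega⟩
  have hcoprime := hM m n hm hn
  rw [← card_slopes (by omega) (by omega)] at hcoprime
  have hordered := mul_card_slopes_le (m := m) (n := n) (by omega) (by omega)
  have hunordered := card_isArcDisjointPair_le (a := ((1, 0) : ZMod m × ZMod n)) (b := (0, 1))
    (N := m * n) (by nlinarith)
  have hle := hordered.trans (Nat.add_le_add_left hunordered _)
  generalize Nat.card _ = U at hle ⊢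
  generalize (slopes m n).card = F at hle hcoprime
  have hle' : (m * n : ℝ) * (4 * F) ≤ m * n * (4 + m * n + 3 * n) + 2 * U := by exact_mod_cast hle
  have hm₁ : (1000 : ℝ) ≤ m := by exact_mod_cast hm'
  have hn₁ : (1000 : ℝ) ≤ n := by exact_mod_cast hn'
  have hsmall : (4 : ℝ) + 3 * n < 8 / 1000 * (m * n) := by nlinarith
  have hpos : (0 : ℝ) < m * n := by positivity
  have h1 := mul_le_mul_of_nonneg_left hcoprime hpos.le
  have h2 := mul_lt_mul_of_pos_left hsmall hpos
  have : (m : ℝ) ^ 2 * n ^ 2 < 10 * U := by nlinarith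
  exact_mod_cast this
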